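/- arXiv:2507.17890 — 4 statements merged into one kernel-verified Lean document; each statement's English description precedes it below -/
import Mathlib

section
/- Let T ∈ A⊗B⊗C and let W_C be a subspace of the flattening image T(C^*) ⊆ A⊗B. Then R(T) ≥ min R(T mod (0, 0, W_C)) + dim W_C. Moreover, if W_C is spanned by rank-one elements of A⊗B, then equality holds. -/
open TensorProduct

/-- The rank of a 3-tensor `T ∈ A ⊗ B ⊗ C`. -/
noncomputable def tRank3 {A B C : Type*} [AddCommGroup A] [Module ℂ A]
    [AddCommGroup B] [Module ℂ B] [AddCommGroup C] [Module ℂ C]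
    (T : A ⊗[ℂ] (B ⊗[ℂ] C)) : ℕ :=
  sInf {r : ℕ | ∃ (a : Fin r → A) (b : Fin r → B) (c : Fin r → C),
    T = ∑ i, a i ⊗ₜ[ℂ] (b i ⊗ₜ[ℂ] c i)}

section Mods

variable {A B C : Type*} [AddCommGroup A] [Module ℂ A]
  [AddCommGroup B] [Module ℂ B] [AddCommGroup C] [Module ℂ C]

/-- The image `T(C^*) ⊆ A ⊗ B` of the flattening `T_C : C^* → A ⊗ B`. -/
noncomputable def flatImageC (T : A ⊗[ℂ] (B ⊗[ℂ] C)) : Submodule ℂ (A ⊗[ℂ] B) :=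
  Submodule.span ℂ {x | ∃ f : Module.Dual ℂ C,
    x = TensorProduct.map LinearMap.id (TensorProduct.rid ℂ B).toLinearMap
      (TensorProduct.map LinearMap.id (TensorProduct.map LinearMap.id f) T)}

/-- Modifications of `T` by `(0, 0, W_C)`: all tensors `T + Σᵢ wᵢ ⊗ cᵢ` with `wᵢ ∈ W_C`,
`cᵢ ∈ C`. -/
def modSetC (T : A ⊗[ℂ] (B ⊗[ℂ] C)) (W : Submodule ℂ (A ⊗[ℂ] B)) :
    Set (A ⊗[ℂ] (B ⊗[ℂ] C)) :=
  {T' | ∃ X ∈ Submodule.span ℂ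
      {x | ∃ w ∈ W, ∃ c : C, x = (TensorProduct.assoc ℂ A B C) (w ⊗ₜ[ℂ] c)},
    T' = T + X}

/-- `min R(T mod (0,0,W_C))`: the smallest rank of a modification of `T` by `(0,0,W_C)`. -/
noncomputable def minModRankC (T : A ⊗[ℂ] (B ⊗[ℂ] C)) (W : Submodule ℂ (A ⊗[ℂ] B)) : ℕ :=
  sInf (tRank3 '' modSetC T W)

/-- A subspace of `X ⊗ Y` is spanned by rank-one elements. -/
def spannedByRankOne {X Y : Type*} [AddCommGroup X] [Module ℂ X]
    [AddCommGroup Y] [Module ℂ Y] (W : Submodule ℂ (X ⊗[ℂ] Y)) : Prop :=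
  ∃ S : Set (X ⊗[ℂ] Y), (∀ v ∈ S, v ≠ 0 ∧ ∃ (x : X) (y : Y), v = x ⊗ₜ[ℂ] y) ∧
    W = Submodule.span ℂ S

end Mods

section TensorRank

universe u

variable {A B C : Type*} [AddCommGroup A] [Module ℂ A]
  [AddCommGroup B] [Module ℂ B] [AddCommGroup C] [Module ℂ C]

theorem tRank3_sum_le_card {ι : Type*} [Fintype ι] (a : ι → A) (b : ι → B) (c : ι → C) :
    tRank3 (∑ i, a i ⊗ₜ[ℂ] (b i ⊗ₜ[ℂ] c i)) ≤ Fintype.card ι := by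
  let e := (Fintype.equivFin ι).symm
  exact Nat.sInf_le ⟨a ∘ e, b ∘ e, c ∘ e,
    (e.sum_comp fun i ↦ a i ⊗ₜ[ℂ] (b i ⊗ₜ[ℂ] c i)).symm⟩

theorem exists_eq_sum_tmul_tmul (T : A ⊗[ℂ] (B ⊗[ℂ] C)) :
    ∃ (r : ℕ) (a : Fin r → A) (b : Fin r → B) (c : Fin r → C),
      T = ∑ i, a i ⊗ₜ[ℂ] (b i ⊗ₜ[ℂ] c i) := by
  have of_add {S T : A ⊗[ℂ] (B ⊗[ℂ] C)}
      (hS : ∃ (r : ℕ) (a : Fin r → A) (b : Fin r → B) (c : Fin r → C),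
        S = ∑ i, a i ⊗ₜ[ℂ] (b i ⊗ₜ[ℂ] c i))
      (hT : ∃ (r : ℕ) (a : Fin r → A) (b : Fin r → B) (c : Fin r → C),
        T = ∑ i, a i ⊗ₜ[ℂ] (b i ⊗ₜ[ℂ] c i)) :
      ∃ (r : ℕ) (a : Fin r → A) (b : Fin r → B) (c : Fin r → C),
        S + T = ∑ i, a i ⊗ₜ[ℂ] (b i ⊗ₜ[ℂ] c i) := by
    obtain ⟨r, a, b, c, rfl⟩ := hS
    obtain ⟨s, a', b', c', rfl⟩ := hT
    exact ⟨r + s, Fin.append a a', Fin.append b b', Fin.append c c', by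
      simp [Fin.sum_univ_add]⟩
  induction T using TensorProduct.induction_on with
  | zero => exact ⟨0, 0, 0, 0, by simp⟩
  | add S T hS hT => exact of_add hS hT
  | tmul x y =>
    induction y using TensorProduct.induction_on with
    | zero => exact ⟨0, 0, 0, 0, by simp⟩
    | add y z hy hz =>
      rw [TensorProduct.tmul_add]
      exact of_add hy hz
    | tmul y z => exact ⟨1, fun _ ↦ x, fun _ ↦ y, fun _ ↦ z, by simp⟩

theorem exists_eq_sum_tRank3 (T : A ⊗[ℂ] (B ⊗[ℂ] C)) :
    ∃ (a : Fin (tRank3 T) → A) (b : Fin (tRank3 T) → B) (c : Fin (tRank3 T) → C),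
      T = ∑ i, a i ⊗ₜ[ℂ] (b i ⊗ₜ[ℂ] c i) :=
  Nat.sInf_mem (s := {r : ℕ | ∃ (a : Fin r → A) (b : Fin r → B) (c : Fin r → C),
    T = ∑ i, a i ⊗ₜ[ℂ] (b i ⊗ₜ[ℂ] c i)}) (exists_eq_sum_tmul_tmul T)

theorem tRank3_add_le (S T : A ⊗[ℂ] (B ⊗[ℂ] C)) :
    tRank3 (S + T) ≤ tRank3 S + tRank3 T := by
  obtain ⟨a, b, c, hS⟩ := exists_eq_sum_tRank3 S
  obtain ⟨a', b', c', hT⟩ := exists_eq_sum_tRank3 T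
  have h := tRank3_sum_le_card (Sum.elim a a') (Sum.elim b b') (Sum.elim c c')
  simpa [← hS, ← hT] using h

theorem minModRankC_le {T T' : A ⊗[ℂ] (B ⊗[ℂ] C)} {W : Submodule ℂ (A ⊗[ℂ] B)}
    (h : T' ∈ modSetC T W) : minModRankC T W ≤ tRank3 T' :=
  Nat.sInf_le ⟨T', h, rfl⟩

theorem exists_mem_modSetC_tRank3_eq (T : A ⊗[ℂ] (B ⊗[ℂ] C)) (W : Submodule ℂ (A ⊗[ℂ] B)) :
    ∃ T' ∈ modSetC T W, tRank3 T' = minModRankC T W :=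
  Nat.sInf_mem (s := tRank3 '' modSetC T W) ⟨_, T, ⟨0, zero_mem _, by simp⟩, rfl⟩

theorem flatImageC_sum_le {ι : Type*} [Fintype ι] (a : ι → A) (b : ι → B) (c : ι → C) :
    flatImageC (∑ i, a i ⊗ₜ[ℂ] (b i ⊗ₜ[ℂ] c i)) ≤
      Submodule.span ℂ (Set.range fun i ↦ a i ⊗ₜ[ℂ] b i) := by
  refine Submodule.span_le.2 ?_
  rintro _ ⟨f, rfl⟩
  simp only [map_sum, TensorProduct.map_tmul, LinearMap.id_apply, LinearEquiv.coe_coe,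
    TensorProduct.rid_tmul, TensorProduct.tmul_smul]
  exact sum_mem fun i _ ↦ Submodule.smul_mem _ _ (Submodule.subset_span ⟨i, rfl⟩)

/-- Modulo a subspace `W` of the span of a finite family `v`, some subfamily of `v` with
at most `|v| - dim W` members still spans. -/
theorem exists_subfamily_spanning_mod {K V : Type*} {ι : Type u} [Field K] [AddCommGroup V] [Module K V]
    [Fintype ι] (v : ι → V) (W : Submodule K V) (hW : W ≤ Submodule.span K (Set.range v)) :
    ∃ (κ : Type u) (_ : Fintype κ) (g : κ → ι),
      Fintype.card κ + Module.finrank K W ≤ Fintype.card ι ∧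
      ∀ i, ∃ m : κ → K, v i - ∑ j, m j • v (g j) ∈ W := by
  obtain ⟨κ, g, hg, hspan, hli⟩ := exists_linearIndependent' K (W.mkQ ∘ v)
  have : Finite κ := Finite.of_injective g hg
  let _ := Fintype.ofFinite κ
  refine ⟨κ, inferInstance, g, ?_, fun i ↦ ?_⟩
  · let S := Submodule.span K (Set.range v)
    have : FiniteDimensional K S := FiniteDimensional.span_of_finite K (Set.finite_range v)
    have hcard : Module.finrank K (S.map W.mkQ) = Fintype.card κ := by
      rw [← finrank_span_eq_card hli, hspan, Submodule.map_span, Set.range_comp]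
    have hrn := (W.mkQ.domRestrict S).finrank_range_add_finrank_ker
    rw [LinearMap.range_domRestrict, LinearMap.ker_domRestrict, Submodule.ker_mkQ, hcard,
      (Submodule.comapSubtypeEquivOfLe hW).finrank_eq] at hrn
    exact hrn.trans_le (finrank_range_le_card v)
  · have hi : W.mkQ (v i) ∈ Submodule.span K (Set.range ((W.mkQ ∘ v) ∘ g)) := by
      rw [hspan]
      exact Submodule.subset_span ⟨i, rfl⟩
    obtain ⟨m, hm⟩ := (Submodule.mem_span_range_iff_exists_fun K).1 hi
    refine ⟨m, ?_⟩
    rw [← Submodule.ker_mkQ W, LinearMap.mem_ker, map_sub, map_sum, ← hm]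
    simp

theorem minModRankC_add_finrank_le (T : A ⊗[ℂ] (B ⊗[ℂ] C)) (W : Submodule ℂ (A ⊗[ℂ] B))
    (hW : W ≤ flatImageC T) : minModRankC T W + Module.finrank ℂ W ≤ tRank3 T := by
  obtain ⟨a, b, c, hT⟩ := exists_eq_sum_tRank3 T
  generalize tRank3 T = r at a b c hT ⊢
  have hWv : W ≤ Submodule.span ℂ (Set.range fun i ↦ a i ⊗ₜ[ℂ] b i) :=
    hW.trans (hT ▸ flatImageC_sum_le a b c)
  obtain ⟨κ, _, g, hcard, hm⟩ := exists_subfamily_spanning_mod _ W hWv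
  choose m hm using hm
  have hmem : ∑ j, a (g j) ⊗ₜ[ℂ] (b (g j) ⊗ₜ[ℂ] ∑ i, m i j • c i) ∈ modSetC T W := by
    refine ⟨-∑ i, TensorProduct.assoc ℂ A B C
      ((a i ⊗ₜ[ℂ] b i - ∑ j, m i j • (a (g j) ⊗ₜ[ℂ] b (g j))) ⊗ₜ[ℂ] c i),
      neg_mem (sum_mem fun i _ ↦ Submodule.subset_span ⟨_, hm i, c i, rfl⟩), ?_⟩
    rw [hT]
    simp only [TensorProduct.sub_tmul, TensorProduct.sum_tmul, TensorProduct.tmul_sum,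
      TensorProduct.smul_tmul, TensorProduct.tmul_smul, map_sub, map_sum, map_smul,
      TensorProduct.assoc_tmul, Finset.sum_sub_distrib]
    rw [Finset.sum_comm]
    abel
  have h := (minModRankC_le hmem).trans (tRank3_sum_le_card _ _ _)
  rw [Fintype.card_fin] at hcard
  omega

theorem tRank3_le_finrank_of_spannedByRankOne [FiniteDimensional ℂ A] [FiniteDimensional ℂ B]
    {W : Submodule ℂ (A ⊗[ℂ] B)} (hW : spannedByRankOne W) {X : A ⊗[ℂ] (B ⊗[ℂ] C)}
    (hX : X ∈ Submodule.span ℂ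
      {x | ∃ w ∈ W, ∃ c : C, x = (TensorProduct.assoc ℂ A B C) (w ⊗ₜ[ℂ] c)}) :
    tRank3 X ≤ Module.finrank ℂ W := by
  obtain ⟨S, hS, rfl⟩ := hW
  obtain ⟨κ, g, -, hspan, hli⟩ := exists_linearIndependent' ℂ ((↑) : S → A ⊗[ℂ] B)
  rw [Subtype.range_coe] at hspan
  have : Finite κ := hli.finite
  let _ := Fintype.ofFinite κ
  choose a b hab using fun k ↦ (hS (g k) (g k).2).2
  have hXc : ∃ c : κ → C, X = ∑ k, a k ⊗ₜ[ℂ] (b k ⊗ₜ[ℂ] c k) := by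
    induction hX using Submodule.span_induction with
    | mem x hx =>
      obtain ⟨w, hw, c, rfl⟩ := hx
      rw [← hspan] at hw
      obtain ⟨m, rfl⟩ := (Submodule.mem_span_range_iff_exists_fun ℂ).1 hw
      refine ⟨fun k ↦ m k • c, ?_⟩
      simp [hab, TensorProduct.sum_tmul, TensorProduct.smul_tmul]
    | zero => exact ⟨0, by simp⟩
    | add x y _ _ hx hy =>
      obtain ⟨c, rfl⟩ := hx
      obtain ⟨d, rfl⟩ := hy
      exact ⟨c + d, by simp [TensorProduct.tmul_add, Finset.sum_add_distrib]⟩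
    | smul t x _ hx =>
      obtain ⟨c, rfl⟩ := hx
      exact ⟨t • c, by simp [Finset.smul_sum]⟩
  obtain ⟨c, rfl⟩ := hXc
  rw [← hspan, finrank_span_eq_card hli]
  exact tRank3_sum_le_card a b c

end TensorRank

/-- If `W_C ⊆ T(C^*)`, then `R(T) ≥ min R(T mod (0,0,W_C)) + dim W_C`, with equality
when `W_C` is spanned by rank-one elements. -/
theorem rank_mod_flattening_subspace (A B C : Type*) [AddCommGroup A] [Module ℂ A]
    [FiniteDimensional ℂ A] [AddCommGroup B] [Module ℂ B] [FiniteDimensional ℂ B]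
    [AddCommGroup C] [Module ℂ C] [FiniteDimensional ℂ C]
    (T : A ⊗[ℂ] (B ⊗[ℂ] C)) (W : Submodule ℂ (A ⊗[ℂ] B)) (hW : W ≤ flatImageC T) :
    minModRankC T W + Module.finrank ℂ W ≤ tRank3 T ∧
    (spannedByRankOne W → tRank3 T = minModRankC T W + Module.finrank ℂ W) := by
  have hlower := minModRankC_add_finrank_le T W hW
  refine ⟨hlower, fun hone ↦ le_antisymm ?_ hlower⟩
  obtain ⟨_, ⟨X, hX, rfl⟩, hmin⟩ := exists_mem_modSetC_tRank3_eq T W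
  have hneg := tRank3_le_finrank_of_spannedByRankOne hone (neg_mem hX)
  have hadd := tRank3_add_le (T + X) (-X)
  rw [add_neg_cancel_right] at hadd
  omega
end

section
/- In the Φ-tensor construction, for every i = 1,…,r, the sum of the diagonal blocks over all σ^{2θ} functions Φ : {1,…,θ} → {0,…,σ²−1} is the all-ones matrix: Σ_Φ M^Φ_{ii} = Σ_{φ,ψ ∈ Σ_θ} φ⊗ψ, the sum over all pairs of canonical basis tensors of (ℂ^σ)^{⊗θ}. -/
open TensorProduct

/-- `(ℂ^σ)^{⊗θ}`, realized as the space of functions on multi-indices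
`(α₁,…,α_θ) ∈ (Fin σ)^θ`. -/
abbrev Wsp (θ σ : ℕ) : Type := (Fin θ → Fin σ) → ℂ

/-- The canonical basis vector `e_{α₁} ⊗ ⋯ ⊗ e_{α_θ}` of `(ℂ^σ)^{⊗θ}`. -/
noncomputable def bvec {θ σ : ℕ} (φ : Fin θ → Fin σ) : Wsp θ σ := Pi.single φ 1

/-- Selection of one of the two components of a pair in `Fin σ × Fin σ` (the pair encodes an
element `s ∈ {0,…,σ²−1}` via `s = (u(s,1)−1)σ + (u(s,2)−1)`; `sel p true = u(s,1)`,
`sel p false = u(s,2)`). -/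
def sel {σ : ℕ} (p : Fin σ × Fin σ) (b : Bool) : Fin σ := if b then p.1 else p.2

section Phi

variable {A B : Type*} [AddCommGroup A] [Module ℂ A] [AddCommGroup B] [Module ℂ B]

/-- The Φ-tensor `M^Φ` associated to families `a`, `b` and the functions `π_i`
(here `π i : Fin θ → Bool`, with `true`/`false` standing for the values `1`/`2`, and
`!(π j)` standing for `3 − π_j`). -/
noncomputable def PhiTensor {r θ σ : ℕ} (a : Fin r → A) (b : Fin r → B)
    (π : Fin r → Fin θ → Bool) (Φ : Fin θ → Fin σ × Fin σ) :
    (A ⊗[ℂ] Wsp θ σ) ⊗[ℂ] (B ⊗[ℂ] Wsp θ σ) :=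
  (∑ i, a i ⊗ₜ[ℂ] bvec (fun γ => sel (Φ γ) (π i γ))) ⊗ₜ[ℂ]
    (∑ j, b j ⊗ₜ[ℂ] bvec (fun δ => sel (Φ δ) (!(π j δ))))

/-- The `(i,j)`-block `M(a_i^* ⊗ b_j^*) ∈ W ⊗ W` of `M ∈ (A⊗W)⊗(B⊗W)`. -/
noncomputable def blockOf {θ σ : ℕ} (f : Module.Dual ℂ A) (g : Module.Dual ℂ B)
    (M : (A ⊗[ℂ] Wsp θ σ) ⊗[ℂ] (B ⊗[ℂ] Wsp θ σ)) : Wsp θ σ ⊗[ℂ] Wsp θ σ :=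
  TensorProduct.map
    ((TensorProduct.lid ℂ (Wsp θ σ)).toLinearMap ∘ₗ TensorProduct.map f LinearMap.id)
    ((TensorProduct.lid ℂ (Wsp θ σ)).toLinearMap ∘ₗ TensorProduct.map g LinearMap.id) M

/-- Evaluation of an element of `W ⊗ W` against the pair of dual basis vectors `φ^* ⊗ ψ^*`. -/
noncomputable def evalPair {θ σ : ℕ} (φ ψ : Fin θ → Fin σ) :
    Wsp θ σ ⊗[ℂ] Wsp θ σ →ₗ[ℂ] ℂ :=
  TensorProduct.lift ((LinearMap.mul ℂ ℂ).compl₁₂ (LinearMap.proj φ) (LinearMap.proj ψ))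

/-- The set `𝓤` of unit matrices corresponding to entries that are nonzero in some
off-diagonal block of some Φ-tensor. -/
def Uset {r θ σ : ℕ} (a : Fin r → A) (b : Fin r → B) (π : Fin r → Fin θ → Bool)
    (astar : Fin r → Module.Dual ℂ A) (bstar : Fin r → Module.Dual ℂ B) :
    Set ((A ⊗[ℂ] Wsp θ σ) ⊗[ℂ] (B ⊗[ℂ] Wsp θ σ)) :=
  {x | ∃ i j : Fin r, i ≠ j ∧ ∃ φ ψ : Fin θ → Fin σ,
    (∃ Φ : Fin θ → Fin σ × Fin σ,
      evalPair φ ψ (blockOf (astar i) (bstar j) (PhiTensor a b π Φ)) ≠ 0) ∧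
    x = (a i ⊗ₜ[ℂ] bvec φ) ⊗ₜ[ℂ] (b j ⊗ₜ[ℂ] bvec ψ)}

/-- The space `𝓜 = span(𝓕 ∪ 𝓤)`, where `𝓕` is the set of all Φ-tensors. -/
noncomputable def Msp {r θ σ : ℕ} (a : Fin r → A) (b : Fin r → B)
    (π : Fin r → Fin θ → Bool)
    (astar : Fin r → Module.Dual ℂ A) (bstar : Fin r → Module.Dual ℂ B) :
    Submodule ℂ ((A ⊗[ℂ] Wsp θ σ) ⊗[ℂ] (B ⊗[ℂ] Wsp θ σ)) :=
  Submodule.span ℂ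
    (Set.range (PhiTensor a b π (σ := σ)) ∪ Uset a b π astar bstar)

end Phi

/-- Pairs of multi-indices correspond to multi-indices of pairs, the components at each position
being arranged according to `p`. -/
def selEquiv {θ σ : ℕ} (p : Fin θ → Bool) :
    (Fin θ → Fin σ × Fin σ) ≃ (Fin θ → Fin σ) × (Fin θ → Fin σ) where
  toFun Φ := (fun γ => sel (Φ γ) (p γ), fun δ => sel (Φ δ) (!(p δ)))
  invFun x γ := if p γ then (x.1 γ, x.2 γ) else (x.2 γ, x.1 γ)
  left_inv Φ := by
    funext γ
    cases h : p γ <;> simp [sel, h]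
  right_inv x := by
    ext γ <;> cases h : p γ <;> simp [sel, h]

/-- Blocks of a Φ-tensor with respect to dual families are elementary tensors of basis vectors. -/
theorem blockOf_PhiTensor {A B : Type*} [AddCommGroup A] [Module ℂ A] [AddCommGroup B]
    [Module ℂ B] {r θ σ : ℕ} (a : Fin r → A) (b : Fin r → B) (π : Fin r → Fin θ → Bool)
    (f : Module.Dual ℂ A) (g : Module.Dual ℂ B) (i j : Fin r)
    (hf : ∀ k, f (a k) = if i = k then 1 else 0) (hg : ∀ k, g (b k) = if j = k then 1 else 0)
    (Φ : Fin θ → Fin σ × Fin σ) :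
    blockOf f g (PhiTensor a b π Φ) =
      bvec (fun γ => sel (Φ γ) (π i γ)) ⊗ₜ[ℂ] bvec (fun δ => sel (Φ δ) (!(π j δ))) := by
  simp [blockOf, PhiTensor, hf, hg, ite_smul]

/-- **Diagonal blocks of the Φ-tensors sum to the all-ones matrix.**
In the Φ-tensor construction, for every `i`, the sum over all functions
`Φ : {1,…,θ} → {0,…,σ²−1}` of the diagonal blocks `M^Φ_{ii}` equals
`Σ_{φ,ψ ∈ Σ_θ} φ ⊗ ψ`, the sum over all pairs of canonical basis tensors. -/
theorem sum_diagonal_blocks_all_ones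
    (A B C : Type*) [AddCommGroup A] [Module ℂ A] [FiniteDimensional ℂ A]
    [AddCommGroup B] [Module ℂ B] [FiniteDimensional ℂ B]
    [AddCommGroup C] [Module ℂ C] [FiniteDimensional ℂ C]
    (r ρ θ σ : ℕ) (hr : 0 < r)
    (hρ : ρ = 2 * Module.finrank ℂ A * Module.finrank ℂ B * Module.finrank ℂ C + 1)
    (hθ : θ = Nat.clog 2 r) (hσ : σ = 2 * ρ ^ 2 * r)
    (a : Fin r → A) (b : Fin r → B)
    (ha : LinearIndependent ℂ a) (hb : LinearIndependent ℂ b)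
    (w : A ⊗[ℂ] B) (hw : w = ∑ i, a i ⊗ₜ[ℂ] b i)
    (π : Fin r → Fin θ → Bool) (hπ : Function.Injective π)
    (astar : Fin r → Module.Dual ℂ A) (bstar : Fin r → Module.Dual ℂ B)
    (hastar : ∀ i k, astar i (a k) = if i = k then 1 else 0)
    (hbstar : ∀ j k, bstar j (b k) = if j = k then 1 else 0) :
    ∀ i : Fin r,
      ∑ Φ : Fin θ → Fin σ × Fin σ, blockOf (astar i) (bstar i) (PhiTensor a b π Φ)
        = ∑ φ : Fin θ → Fin σ, ∑ ψ : Fin θ → Fin σ, bvec φ ⊗ₜ[ℂ] bvec ψ := by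
  intro i
  simp only [fun Φ => blockOf_PhiTensor a b π _ _ i i (hastar i) (hbstar i) Φ]
  rw [← Fintype.sum_prod_type']
  exact (selEquiv (π i)).sum_comp fun x => bvec x.1 ⊗ₜ[ℂ] bvec x.2
end

section
/- In the Φ-tensor construction, let M₀ ⊆ M be a subset of cardinality c (= dim C). Then at least one of the following holds: (1) M₀ contains an element of rank at least ρ (as a bilinear form on (A⊗(ℂ^σ)^{⊗θ})^*×(B⊗(ℂ^σ)^{⊗θ})^*); or (2) there exist 2r basis tensors φ_1,…,φ_r, ψ_1,…,ψ_r ∈ Σ_θ such that for every M ∈ M₀ there is a scalar λ ∈ ℂ (depending on M) with M((a_i⊗φ_i)^*⊗(b_j⊗ψ_j)^*) = λ·δ_{ij} for all 1 ≤ i, j ≤ r, i.e., the restriction of M to the span of {a_i⊗φ_i} and {b_j⊗ψ_j} is the scalar r×r matrix λ·Σ_{i=1}^r a_i⊗φ_i⊗b_i⊗ψ_i. -/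
open TensorProduct

/-- The (matrix) rank of a 2-tensor `M ∈ X ⊗ Y`. -/
noncomputable def tRank2 {X Y : Type*} [AddCommGroup X] [Module ℂ X]
    [AddCommGroup Y] [Module ℂ Y] (M : X ⊗[ℂ] Y) : ℕ :=
  sInf {n : ℕ | ∃ (x : Fin n → X) (y : Fin n → Y), M = ∑ i, x i ⊗ₜ[ℂ] y i}

/-- The linear functional picking out the coefficient of `M` against
`(f ⊗ φ^*) ⊗ (g ⊗ ψ^*)`. -/
noncomputable def entryFunctional {A B : Type*} [AddCommGroup A] [Module ℂ A] [AddCommGroup B]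
    [Module ℂ B] {θ σ : ℕ} (f : Module.Dual ℂ A) (g : Module.Dual ℂ B) (φ ψ : Fin θ → Fin σ) :
    (A ⊗[ℂ] Wsp θ σ) ⊗[ℂ] (B ⊗[ℂ] Wsp θ σ) →ₗ[ℂ] ℂ :=
  evalPair φ ψ ∘ₗ TensorProduct.map
    ((TensorProduct.lid ℂ (Wsp θ σ)).toLinearMap ∘ₗ TensorProduct.map f LinearMap.id)
    ((TensorProduct.lid ℂ (Wsp θ σ)).toLinearMap ∘ₗ TensorProduct.map g LinearMap.id)

/-- The coefficient functional `x ↦ x (f ⊗ φ^*)` on `A ⊗ W`. -/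
noncomputable def coeffFunctional {A : Type*} [AddCommGroup A] [Module ℂ A] {θ σ : ℕ}
    (f : Module.Dual ℂ A) (φ : Fin θ → Fin σ) : A ⊗[ℂ] Wsp θ σ →ₗ[ℂ] ℂ :=
  LinearMap.proj φ ∘ₗ (TensorProduct.lid ℂ (Wsp θ σ)).toLinearMap ∘ₗ
    TensorProduct.map f LinearMap.id

section Entries

variable {A B : Type*} [AddCommGroup A] [Module ℂ A] [AddCommGroup B] [Module ℂ B]
  {r θ σ : ℕ}

theorem evalPair_blockOf (f : Module.Dual ℂ A) (g : Module.Dual ℂ B) (φ ψ : Fin θ → Fin σ)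
    (M : (A ⊗[ℂ] Wsp θ σ) ⊗[ℂ] (B ⊗[ℂ] Wsp θ σ)) :
    evalPair φ ψ (blockOf f g M) = entryFunctional f g φ ψ M := rfl

theorem coeffFunctional_tmul (f : Module.Dual ℂ A) (φ : Fin θ → Fin σ) (x : A) (h : Wsp θ σ) :
    coeffFunctional f φ (x ⊗ₜ[ℂ] h) = f x * h φ := by
  simp [coeffFunctional]

theorem entryFunctional_tmul (f : Module.Dual ℂ A) (g : Module.Dual ℂ B) (φ ψ : Fin θ → Fin σ)
    (x : A ⊗[ℂ] Wsp θ σ) (y : B ⊗[ℂ] Wsp θ σ) :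
    entryFunctional f g φ ψ (x ⊗ₜ[ℂ] y) = coeffFunctional f φ x * coeffFunctional g ψ y := by
  simp [entryFunctional, coeffFunctional, evalPair]

theorem coeffFunctional_tmul_bvec {a : Fin r → A} {astar : Fin r → Module.Dual ℂ A}
    (hastar : ∀ i k, astar i (a k) = if i = k then 1 else 0) (i k : Fin r)
    (φ φ' : Fin θ → Fin σ) :
    coeffFunctional (astar i) φ (a k ⊗ₜ[ℂ] bvec φ') = if i = k ∧ φ = φ' then 1 else 0 := by
  rw [coeffFunctional_tmul, hastar, bvec, Pi.single_apply]
  split_ifs <;> simp_all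

theorem coeffFunctional_sum_tmul_bvec {a : Fin r → A} {astar : Fin r → Module.Dual ℂ A}
    (hastar : ∀ i k, astar i (a k) = if i = k then 1 else 0) (i : Fin r)
    (φ : Fin θ → Fin σ) (χ : Fin r → Fin θ → Fin σ) :
    coeffFunctional (astar i) φ (∑ k, a k ⊗ₜ[ℂ] bvec (χ k)) = if φ = χ i then 1 else 0 := by
  simp only [map_sum, coeffFunctional_tmul_bvec hastar, ite_and]
  simp

variable {a : Fin r → A} {b : Fin r → B} {π : Fin r → Fin θ → Bool}
  {astar : Fin r → Module.Dual ℂ A} {bstar : Fin r → Module.Dual ℂ B}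

theorem entryFunctional_PhiTensor
    (hastar : ∀ i k, astar i (a k) = if i = k then 1 else 0)
    (hbstar : ∀ j k, bstar j (b k) = if j = k then 1 else 0)
    (i j : Fin r) (φ ψ : Fin θ → Fin σ) (Φ : Fin θ → Fin σ × Fin σ) :
    entryFunctional (astar i) (bstar j) φ ψ (PhiTensor a b π Φ) =
      (if φ = fun γ => sel (Φ γ) (π i γ) then 1 else 0) *
        (if ψ = fun δ => sel (Φ δ) (!(π j δ)) then 1 else 0) := by
  rw [PhiTensor, entryFunctional_tmul, coeffFunctional_sum_tmul_bvec hastar,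
    coeffFunctional_sum_tmul_bvec hbstar]

theorem entryFunctional_unit
    (hastar : ∀ i k, astar i (a k) = if i = k then 1 else 0)
    (hbstar : ∀ j k, bstar j (b k) = if j = k then 1 else 0)
    (i j k l : Fin r) (φ ψ φ' ψ' : Fin θ → Fin σ) :
    entryFunctional (astar i) (bstar j) φ ψ
      ((a k ⊗ₜ[ℂ] bvec φ') ⊗ₜ[ℂ] (b l ⊗ₜ[ℂ] bvec ψ')) =
      (if i = k ∧ φ = φ' then 1 else 0) * (if j = l ∧ ψ = ψ' then 1 else 0) := by
  rw [entryFunctional_tmul, coeffFunctional_tmul_bvec hastar, coeffFunctional_tmul_bvec hbstar]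

/-- In an off-diagonal block of a Φ-tensor, the entry at two different constant multi-indices
vanishes. -/
theorem entryFunctional_PhiTensor_const_of_ne
    (hastar : ∀ i k, astar i (a k) = if i = k then 1 else 0)
    (hbstar : ∀ j k, bstar j (b k) = if j = k then 1 else 0)
    (hπ : Function.Injective π) {i j : Fin r} (hij : i ≠ j) {v v' : Fin σ} (hv : v ≠ v')
    (Φ : Fin θ → Fin σ × Fin σ) :
    entryFunctional (astar i) (bstar j) (fun _ => v) (fun _ => v') (PhiTensor a b π Φ) = 0 := by
  rw [entryFunctional_PhiTensor hastar hbstar]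
  obtain ⟨δ, hδ⟩ := Function.ne_iff.mp (hπ.ne hij)
  have hsel : π i δ = !(π j δ) := by
    cases h₁ : π i δ <;> cases h₂ : π j δ <;> simp_all
  by_contra h
  rw [mul_eq_zero, not_or] at h
  simp only [ite_eq_right_iff, one_ne_zero, imp_false, not_not] at h
  apply hv
  have h₁ := congrFun h.1 δ
  have h₂ := congrFun h.2 δ
  rw [h₁, h₂, hsel]

theorem entryFunctional_const_of_ne
    (hastar : ∀ i k, astar i (a k) = if i = k then 1 else 0)
    (hbstar : ∀ j k, bstar j (b k) = if j = k then 1 else 0)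
    (hπ : Function.Injective π) {i j : Fin r} (hij : i ≠ j) {v v' : Fin σ} (hv : v ≠ v')
    {M : (A ⊗[ℂ] Wsp θ σ) ⊗[ℂ] (B ⊗[ℂ] Wsp θ σ)} (hM : M ∈ Msp a b π astar bstar) :
    entryFunctional (astar i) (bstar j) (fun _ => v) (fun _ => v') M = 0 := by
  refine Submodule.span_le (p := LinearMap.ker _).mpr ?_ hM
  rintro x (⟨Φ, rfl⟩ | ⟨k, l, -, φ, ψ, ⟨Φ, hΦ⟩, rfl⟩)
  · exact entryFunctional_PhiTensor_const_of_ne hastar hbstar hπ hij hv Φ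
  · rw [SetLike.mem_coe, LinearMap.mem_ker, entryFunctional_unit hastar hbstar]
    by_contra h
    rw [mul_eq_zero, not_or] at h
    simp only [ite_eq_right_iff, one_ne_zero, imp_false, not_not] at h
    obtain ⟨⟨rfl, rfl⟩, rfl, rfl⟩ := h
    exact hΦ (entryFunctional_PhiTensor_const_of_ne hastar hbstar hπ hij hv Φ)

/-- The diagonal blocks of an element of `𝓜` agree at constant multi-indices. -/
theorem entryFunctional_diag_const_eq
    (hastar : ∀ i k, astar i (a k) = if i = k then 1 else 0)
    (hbstar : ∀ j k, bstar j (b k) = if j = k then 1 else 0)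
    (i j : Fin r) (v : Fin σ)
    {M : (A ⊗[ℂ] Wsp θ σ) ⊗[ℂ] (B ⊗[ℂ] Wsp θ σ)} (hM : M ∈ Msp a b π astar bstar) :
    entryFunctional (astar i) (bstar i) (fun _ => v) (fun _ => v) M =
      entryFunctional (astar j) (bstar j) (fun _ => v) (fun _ => v) M := by
  refine Submodule.span_le (p := LinearMap.eqLocus (entryFunctional _ _ _ _)
    (entryFunctional _ _ _ _)).mpr ?_ hM
  rintro x (⟨Φ, rfl⟩ | ⟨k, l, hkl, φ, ψ, -, rfl⟩)
  · have key (i : Fin r) :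
        entryFunctional (astar i) (bstar i) (fun _ => v) (fun _ => v) (PhiTensor a b π Φ) =
          if ∀ δ, v = (Φ δ).1 ∧ v = (Φ δ).2 then 1 else 0 := by
      rw [entryFunctional_PhiTensor hastar hbstar, ite_zero_mul_ite_zero, mul_one]
      congr 1
      simp only [funext_iff, ← forall_and, eq_iff_iff]
      refine forall_congr' fun δ => ?_
      cases π i δ <;> simp [sel, and_comm]
    rw [SetLike.mem_coe, LinearMap.mem_eqLocus, key i, key j]
  · have key (i : Fin r) : entryFunctional (astar i) (bstar i) (fun _ => v) (fun _ => v)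
        ((a k ⊗ₜ[ℂ] bvec φ) ⊗ₜ[ℂ] (b l ⊗ₜ[ℂ] bvec ψ)) = 0 := by
      rw [entryFunctional_unit hastar hbstar, ite_zero_mul_ite_zero, if_neg]
      rintro ⟨⟨rfl, -⟩, rfl, -⟩
      exact hkl rfl
    rw [SetLike.mem_coe, LinearMap.mem_eqLocus, key i, key j]

end Entries

theorem exists_eq_sum_tmul_tRank2 {X Y : Type*} [AddCommGroup X] [Module ℂ X]
    [AddCommGroup Y] [Module ℂ Y] (M : X ⊗[ℂ] Y) :
    ∃ (x : Fin (tRank2 M) → X) (y : Fin (tRank2 M) → Y), M = ∑ i, x i ⊗ₜ[ℂ] y i := by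
  refine Nat.sInf_mem (s := {n : ℕ | ∃ (x : Fin n → X) (y : Fin n → Y),
    M = ∑ i, x i ⊗ₜ[ℂ] y i}) ?_
  induction M using TensorProduct.induction_on with
  | zero => exact ⟨0, Fin.elim0, Fin.elim0, by simp⟩
  | tmul x y => exact ⟨1, fun _ => x, fun _ => y, by simp⟩
  | add M N hM hN =>
    obtain ⟨m, x, y, rfl⟩ := hM
    obtain ⟨n, x', y', rfl⟩ := hN
    exact ⟨m + n, Fin.append x x', Fin.append y y', by simp [Fin.sum_univ_add]⟩

/-- If `M` restricts to a diagonal matrix along families of functionals `p`, `q`, then the number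
of nonzero diagonal entries is at most the rank of `M`. -/
theorem card_ne_zero_le_tRank2 {X Y ι : Type*} [AddCommGroup X] [Module ℂ X]
    [AddCommGroup Y] [Module ℂ Y] [Fintype ι] [DecidableEq ι] (p : ι → Module.Dual ℂ X)
    (q : ι → Module.Dual ℂ Y) (E : ι → ι → X ⊗[ℂ] Y →ₗ[ℂ] ℂ)
    (hE : ∀ s t x y, E s t (x ⊗ₜ[ℂ] y) = p s x * q t y) (M : X ⊗[ℂ] Y)
    (hM : ∀ s t, s ≠ t → E s t M = 0) :
    (Finset.univ.filter fun s => E s s M ≠ 0).card ≤ tRank2 M := by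
  obtain ⟨x, y, hxy⟩ := exists_eq_sum_tmul_tRank2 M
  let P : Matrix ι (Fin (tRank2 M)) ℂ := Matrix.of fun s k => p s (x k)
  let Q : Matrix (Fin (tRank2 M)) ι ℂ := Matrix.of fun k t => q t (y k)
  have hPQ : P * Q = Matrix.diagonal fun s => E s s M := by
    ext s t
    have hst : (P * Q) s t = E s t M := by
      conv_rhs => rw [hxy, map_sum]
      simp only [hE]
      rfl
    rw [hst, Matrix.diagonal_apply]
    split_ifs with h
    · rw [h]
    · exact hM s t h
  calc (Finset.univ.filter fun s => E s s M ≠ 0).card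
      = (Matrix.diagonal fun s => E s s M).rank := by
        rw [Matrix.rank_diagonal, Fintype.card_subtype]
    _ ≤ P.rank := hPQ ▸ Matrix.rank_mul_le_left P Q
    _ ≤ tRank2 M := by simpa using P.rank_le_card_width

/-- **Dichotomy for small subsets of `𝓜`.** In the Φ-tensor construction, if `𝓜₀ ⊆ 𝓜` has
cardinality `c = dim C`, then either `𝓜₀` contains an element of rank at least `ρ`, or
there are basis tensors `φ₁,…,φ_r, ψ₁,…,ψ_r ∈ Σ_θ` such that every `M ∈ 𝓜₀` restricts to a
scalar `r × r` matrix: `M((aᵢ⊗φᵢ)* ⊗ (bⱼ⊗ψⱼ)*) = λ·δᵢⱼ` for some `λ ∈ ℂ`. -/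
theorem Msp_subset_dichotomy
    (A B C : Type*) [AddCommGroup A] [Module ℂ A] [FiniteDimensional ℂ A]
    [AddCommGroup B] [Module ℂ B] [FiniteDimensional ℂ B]
    [AddCommGroup C] [Module ℂ C] [FiniteDimensional ℂ C]
    (r ρ θ σ : ℕ) (hr : 0 < r)
    (hρ : ρ = 2 * Module.finrank ℂ A * Module.finrank ℂ B * Module.finrank ℂ C + 1)
    (hθ : θ = Nat.clog 2 r) (hσ : σ = 2 * ρ ^ 2 * r)
    (a : Fin r → A) (b : Fin r → B)
    (ha : LinearIndependent ℂ a) (hb : LinearIndependent ℂ b)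
    (w : A ⊗[ℂ] B) (hw : w = ∑ i, a i ⊗ₜ[ℂ] b i)
    (π : Fin r → Fin θ → Bool) (hπ : Function.Injective π)
    (astar : Fin r → Module.Dual ℂ A) (bstar : Fin r → Module.Dual ℂ B)
    (hastar : ∀ i k, astar i (a k) = if i = k then 1 else 0)
    (hbstar : ∀ j k, bstar j (b k) = if j = k then 1 else 0)
    (M₀ : Finset ((A ⊗[ℂ] Wsp θ σ) ⊗[ℂ] (B ⊗[ℂ] Wsp θ σ)))
    (hM₀ : ↑M₀ ⊆ (Msp (σ := σ) a b π astar bstar : Set ((A ⊗[ℂ] Wsp θ σ) ⊗[ℂ] (B ⊗[ℂ] Wsp θ σ))))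
    (hcard : M₀.card = Module.finrank ℂ C) :
    (∃ M ∈ M₀, ρ ≤ tRank2 M) ∨
    (∃ φ ψ : Fin r → (Fin θ → Fin σ), ∀ M ∈ M₀, ∃ lam : ℂ, ∀ i j : Fin r,
      evalPair (φ i) (ψ j) (blockOf (astar i) (bstar j) M)
        = if i = j then lam else 0) := by
  rw [or_iff_not_imp_left]
  intro hrank
  push Not at hrank
  classical
  have hrA : r ≤ Module.finrank ℂ A := by simpa using ha.fintype_card_le_finrank
  have hrB : r ≤ Module.finrank ℂ B := by simpa using hb.fintype_card_le_finrank
  let bad (x : _ × Fin r × Fin r) : Finset (Fin σ) :=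
    if x.2.1 = x.2.2 then ∅ else Finset.univ.filter fun v =>
      entryFunctional (astar x.2.1) (bstar x.2.2) (fun _ : Fin θ => v) (fun _ => v) x.1 ≠ 0
  have hbad : ∀ x ∈ M₀ ×ˢ (Finset.univ : Finset (Fin r × Fin r)), (bad x).card ≤ ρ := by
    rintro ⟨M, i, j⟩ hx
    have hM : M ∈ M₀ := (Finset.mem_product.mp hx).1
    by_cases hij : i = j
    · simp [bad, hij]
    · simp only [bad, if_neg hij]
      exact (card_ne_zero_le_tRank2 (fun v => coeffFunctional (astar i) fun _ => v)
        (fun v => coeffFunctional (bstar j) fun _ => v)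
        (fun v v' => entryFunctional (astar i) (bstar j) (fun _ => v) fun _ => v')
        (fun _ _ _ _ => entryFunctional_tmul _ _ _ _ _ _) M
        fun _ _ hv => entryFunctional_const_of_ne hastar hbstar hπ hij hv (hM₀ hM)).trans
        (hrank M hM).le
  have hcount : ((M₀ ×ˢ (Finset.univ : Finset (Fin r × Fin r))).biUnion bad).card <
      (Finset.univ : Finset (Fin σ)).card := by
    refine (Finset.card_biUnion_le_card_mul _ _ _ hbad).trans_lt ?_
    rw [Finset.card_product, hcard]
    simp only [Finset.card_univ, Fintype.card_prod, Fintype.card_fin]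
    have hcr : Module.finrank ℂ C * r ≤ ρ := by
      have h : r * 1 * Module.finrank ℂ C ≤
          Module.finrank ℂ A * Module.finrank ℂ B * Module.finrank ℂ C := by
        gcongr
        omega
      rw [hρ]
      linarith
    have hρpos : 0 < ρ := by omega
    calc Module.finrank ℂ C * (r * r) * ρ = Module.finrank ℂ C * r * (r * ρ) := by ring
      _ ≤ ρ * (r * ρ) := by gcongr
      _ < 2 * (ρ * (r * ρ)) := by
        have : 0 < ρ * (r * ρ) := by positivity
        omega
      _ = σ := by rw [hσ]; ring
  obtain ⟨v, -, hv⟩ := Finset.exists_mem_notMem_of_card_lt_card hcount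
  refine ⟨fun _ _ => v, fun _ _ => v, fun M hM =>
    ⟨entryFunctional (astar ⟨0, hr⟩) (bstar ⟨0, hr⟩) (fun _ => v) (fun _ => v) M,
      fun i j => ?_⟩⟩
  rw [evalPair_blockOf]
  split_ifs with hij
  · subst hij
    exact entryFunctional_diag_const_eq hastar hbstar _ _ v (hM₀ hM)
  · by_contra h
    refine hv (Finset.mem_biUnion.mpr ⟨(M, i, j), by simp [hM], ?_⟩)
    simpa [bad, hij] using h
end

section
/- There exist ε ∈ ℝ_{>0} and m̄ ∈ ℤ_{>0} such that for every integer m > m̄ the intersection V¹_{m,ε} ∩ V²_{m,ε} is nonempty. -/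
/-- The rank of a tensor in `(ℂ^m)^{⊗3}`, realized as a 3-dimensional array. -/
noncomputable def rank3 {m : ℕ} (T : Fin m × Fin m × Fin m → ℂ) : ℕ :=
  sInf {r : ℕ | ∃ x y z : Fin r → Fin m → ℂ,
    T = fun p => ∑ α, x α p.1 * y α p.2.1 * z α p.2.2}

/-- `r_{m,ε} = ⌈(1+ε)m²/3⌉`. -/
noncomputable def rme (m : ℕ) (ε : ℝ) : ℕ := ⌈(1 + ε) * (m : ℝ) ^ 2 / 3⌉₊

/-- Application of an `m × m` matrix to a vector. -/
noncomputable def apMat {m : ℕ} (Φ : Fin m → Fin m → ℂ) (v : Fin m → ℂ) : Fin m → ℂ :=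
  fun i => ∑ j, Φ i j * v j

/-- The tensor `T¹_{Φ_A,Φ_B,Φ_C}(p)`. -/
noncomputable def T1 {m r : ℕ} (x y z ξ η τ : Fin r → Fin m → ℂ)
    (ΦA ΦB ΦC : Fin m → Fin m → ℂ) : Fin m × Fin m × Fin m → ℂ :=
  fun p => ∑ α,
    (x α p.1 * y α p.2.1 * z α p.2.2
      + apMat ΦA (ξ α) p.1 * y α p.2.1 * z α p.2.2
      + x α p.1 * apMat ΦB (η α) p.2.1 * z α p.2.2
      + x α p.1 * y α p.2.1 * apMat ΦC (τ α) p.2.2)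

/-- The tensor `T²_{Φ_A,Φ_B,Φ_C}(p)`. -/
noncomputable def T2 {m r : ℕ} (x y z ξ η τ : Fin r → Fin m → ℂ)
    (ΦA ΦB ΦC : Fin m → Fin m → ℂ) : Fin m × Fin m × Fin m → ℂ :=
  fun p => ∑ α,
    (ξ α p.1 * η α p.2.1 * τ α p.2.2
      + apMat ΦA (x α) p.1 * η α p.2.1 * τ α p.2.2
      + ξ α p.1 * apMat ΦB (y α) p.2.1 * τ α p.2.2
      + ξ α p.1 * η α p.2.1 * apMat ΦC (z α) p.2.2)

/-- A finite family has a maximal independent subfamily compatible with the levels of `o`. -/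
theorem exists_linearIndepOn_forall_mem_span {K I E : Type*} [DivisionRing K] [AddCommGroup E]
    [Module K E] [Finite I] (o : I → ℕ) (v : I → E) :
    ∃ B : Set I, LinearIndepOn K v B ∧
      ∀ p, v p ∈ Submodule.span K (v '' {β ∈ B | o β ≤ o p}) := by
  have key : ∀ n : ℕ, ∃ B ⊆ {p | o p < n}, LinearIndepOn K v B ∧
      ∀ p, o p < n → v p ∈ Submodule.span K (v '' {β ∈ B | o β ≤ o p}) := by
    intro n
    induction n with
    | zero => exact ⟨∅, by simp, linearIndepOn_empty K v, by simp⟩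
    | succ n ih =>
      obtain ⟨B, hB, hind, hspan⟩ := ih
      obtain ⟨b, hb, hBb, hsp, hbi⟩ := exists_linearIndepOn_extension hind
        (hB.trans fun p (hp : o p < n) => (Nat.lt_succ_of_lt hp : p ∈ {p | o p < n + 1}))
      refine ⟨b, hb, hbi, fun p hp => ?_⟩
      rcases Nat.lt_succ_iff_lt_or_eq.1 hp with h | h
      · refine Submodule.span_mono (Set.image_mono ?_) (hspan p h)
        exact fun β hβ => ⟨hBb hβ.1, hβ.2⟩
      · refine Submodule.span_mono (Set.image_mono ?_) (hsp (Set.mem_image_of_mem v hp))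
        exact fun β hβ => ⟨hβ, (Nat.lt_succ_iff.1 (hb hβ)).trans_eq h.symm⟩
  obtain ⟨M, hM⟩ := (Set.finite_range o).bddAbove
  obtain ⟨B, -, hB, h⟩ := key (M + 1)
  exact ⟨B, hB, fun p => h p (Nat.lt_succ_of_le (hM ⟨p, rfl⟩))⟩

/-- Every subfamily contains a basis of its span modulo a given submodule. -/
theorem exists_finset_independent_mod {K J E : Type*} [Field K] [AddCommGroup E] [Module K E]
    [Fintype J] (W : Submodule K E) (A : J → E) (S : Set J) :
    ∃ T : Finset J, (T : Set J) ⊆ S ∧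
      (∀ c : J → K, (∀ j ∉ T, c j = 0) → ∑ j, c j • A j ∈ W → ∀ j, c j = 0) ∧
      ∀ j ∈ S, A j ∈ W ⊔ Submodule.span K (A '' T) := by
  classical
  obtain ⟨b, hb, -, hsp, hbi⟩ := exists_linearIndepOn_extension
    (linearIndepOn_empty K (W.mkQ ∘ A)) (Set.empty_subset S)
  refine ⟨b.toFinset, by simpa using hb, fun c hc hW j => ?_, fun j hj => ?_⟩
  · by_cases hj : j ∈ b.toFinset
    · refine linearIndepOn_finset_iff.1 (by rwa [Set.coe_toFinset]) c ?_ j hj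
      rw [← Submodule.ker_mkQ W, LinearMap.mem_ker, map_sum] at hW
      rw [← hW, Finset.sum_subset (Finset.subset_univ _)]
      · simp
      · intro i _ hi
        simp [hc i hi]
    · exact hc j hj
  · have h := hsp (Set.mem_image_of_mem _ hj)
    rw [Set.image_comp, Submodule.span_image, SetLike.mem_coe, Submodule.mem_map] at h
    obtain ⟨e, he, hej⟩ := h
    rw [Submodule.mkQ_apply, Function.comp_apply, Submodule.mkQ_apply,
      eq_comm, Submodule.Quotient.eq] at hej
    rw [← sub_add_cancel (A j) e]
    exact Submodule.add_mem_sup hej (by simpa using he)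

/-- If a family of derivations restricted to directions in `X` is determined by its values on
finitely many elements `g y`, then `X` is no larger than the number of these elements. -/
theorem card_le_of_derivation_injOn {k A Q Y : Type*} [CommRing k] [Field A] [Algebra k A]
    [Fintype Q] [Fintype Y] (Δ : (Q → A) →ₗ[A] Derivation k A A) (g : Y → A) (X : Finset Q)
    (h : ∀ c, (∀ q ∉ X, c q = 0) → (∀ y, Δ c (g y) = 0) → ∀ q, c q = 0) :
    X.card ≤ Fintype.card Y := by
  classical
  let ext : (X → A) →ₗ[A] Q → A := Function.ExtendByZero.linearMap A Subtype.val
  let ev : (Q → A) →ₗ[A] Y → A := LinearMap.pi fun y =>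
    { toFun := fun c => Δ c (g y), map_add' := by simp, map_smul' := by simp }
  have hinj : Function.Injective (ev ∘ₗ ext) := by
    rw [← LinearMap.ker_eq_bot, LinearMap.ker_eq_bot']
    intro c hc
    have h0 := h (ext c) (fun q hq => Function.extend_apply' _ _ _ (by simpa using hq))
      (fun y => congrFun hc y)
    ext q
    have := h0 q
    rwa [Function.ExtendByZero.linearMap_apply, Subtype.val_injective.extend_apply] at this
  simpa using LinearMap.finrank_le_finrank_of_injective hinj

/-- Spans of vectors with constant entries are stable under entrywise derivation. -/
theorem derivation_comp_mem_span {k A X : Type*} [CommRing k] [Field A] [Algebra k A]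
    (D : Derivation k A A) {s : Set (X → A)} (hs : ∀ v ∈ s, ∀ x, D (v x) = 0) {v : X → A}
    (hv : v ∈ Submodule.span A s) : (fun x => D (v x)) ∈ Submodule.span A s := by
  induction hv using Submodule.span_induction with
  | mem v hv =>
    convert Submodule.zero_mem _ using 1
    exact funext (hs v hv)
  | zero => simp [← Pi.zero_def]
  | add v w _ _ hv hw =>
    convert Submodule.add_mem _ hv hw using 1
    ext x
    simp
  | smul c v hv' hv =>
    convert Submodule.add_mem _ (Submodule.smul_mem _ c hv) (Submodule.smul_mem _ (D c) hv') using 1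
    ext x
    simp [mul_comm]

/-- A derivation of a polynomial ring extends along a formally étale algebra. -/
theorem exists_derivation_extends {R S T : Type*} [CommRing R] [CommRing S] [CommRing T]
    [Algebra R S] [Algebra S T] [Algebra R T] [IsScalarTower R S T] [Algebra.FormallyEtale S T]
    (d : Derivation R S T) :
    ∃ D : Derivation R T T, ∀ s, D (algebraMap S T s) = d s := by
  let e := KaehlerDifferential.tensorKaehlerEquivOfFormallyEtale R S T
  let f : TensorProduct S T (Ω[S⁄R]) →ₗ[T] T := d.liftKaehlerDifferential.liftBaseChange T
  refine ⟨(f ∘ₗ e.symm.toLinearMap).compDer (KaehlerDifferential.D R T), fun s => ?_⟩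
  simp [e, f, KaehlerDifferential.tensorKaehlerEquivOfFormallyEtale_symm_D_algebraMap]

open scoped IntermediateField.algebraAdjoinAdjoin in
/-- Derivatives can be prescribed arbitrarily on a transcendence basis in characteristic zero. -/
theorem IsTranscendenceBasis.exists_derivation {K L ι : Type*} [Field K] [Field L] [CharZero K]
    [Algebra K L] {t : ι → L} (ht : IsTranscendenceBasis K t) (c : ι → L) :
    ∃ D : Derivation K L L, ∀ i, D (t i) = c i := by
  have : Algebra.IsAlgebraic (IntermediateField.adjoin K (Set.range t)) L := ht.isAlgebraic_field
  have : Algebra.FormallyEtale (IntermediateField.adjoin K (Set.range t)) L := .of_isSeparable _ L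
  have : Algebra.FormallyEtale (Algebra.adjoin K (Set.range t))
      (IntermediateField.adjoin K (Set.range t)) := .of_isLocalization (nonZeroDivisors _)
  have : Algebra.FormallyEtale (Algebra.adjoin K (Set.range t)) L :=
    .comp _ (IntermediateField.adjoin K (Set.range t)) _
  let e : MvPolynomial ι K ≃ₐ[K] Algebra.adjoin K (Set.range t) := ht.1.aevalEquiv
  let : Algebra (MvPolynomial ι K) (Algebra.adjoin K (Set.range t)) := e.toRingHom.toAlgebra
  let : Algebra (MvPolynomial ι K) L := (MvPolynomial.aeval t).toAlgebra
  have : IsScalarTower (MvPolynomial ι K) (Algebra.adjoin K (Set.range t)) L :=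
    .of_algebraMap_eq fun p => (ht.1.algebraMap_aevalEquiv p).symm
  have : Algebra.FormallyEtale (MvPolynomial ι K) (Algebra.adjoin K (Set.range t)) :=
    .of_equiv (AlgEquiv.ofBijective (Algebra.ofId _ _) e.bijective)
  have : Algebra.FormallyEtale (MvPolynomial ι K) L := .comp _ (Algebra.adjoin K (Set.range t)) _
  have : IsScalarTower K (MvPolynomial ι K) L :=
    .of_algebraMap_eq fun r => ((MvPolynomial.aeval t).commutes r).symm
  obtain ⟨D, hD⟩ := exists_derivation_extends (R := K) (T := L) (MvPolynomial.mkDerivation K c)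
  refine ⟨D, fun i => ?_⟩
  have h := hD (MvPolynomial.X i)
  rw [RingHom.algebraMap_toAlgebra] at h
  simpa using h

/-- Finitely many complex numbers with arbitrarily prescribed derivatives. -/
theorem exists_derivations (ι : Type) [Finite ι] :
    ∃ (P : ι → ℂ) (Δ : (ι → ℂ) →ₗ[ℂ] Derivation ℚ ℂ ℂ), ∀ c i, Δ c (P i) = c i := by
  classical
  have := Fintype.ofFinite ι
  obtain ⟨κ, t, ht⟩ := exists_isTranscendenceBasis' ℚ ℂ
  have hκ := IsAlgClosed.cardinal_eq_cardinal_transcendence_basis_of_aleph0_lt' t ht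
    (by simp) (by simpa using Cardinal.aleph0_lt_continuum)
  have : Infinite κ := by
    rw [Cardinal.infinite_iff, ← hκ]
    simpa using Cardinal.aleph0_lt_continuum.le
  obtain ⟨g, hg⟩ : ∃ g : ι → κ, Function.Injective g :=
    ⟨_, ((Fintype.equivFin ι).toEmbedding.trans (Fin.valEmbedding.trans
      (Infinite.natEmbedding κ))).injective⟩
  choose d hd using fun i : ι => ht.exists_derivation (Pi.single (g i) 1)
  refine ⟨t ∘ g, Fintype.linearCombination ℂ d, fun c i => ?_⟩
  simp only [Fintype.linearCombination_apply, Function.comp_apply]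
  rw [← Derivation.coeFnAddMonoidHom_apply, map_sum, Finset.sum_apply]
  simp [hd, Pi.single_apply, hg.eq_iff]

theorem derivation_apMat {m : ℕ} {D : Derivation ℚ ℂ ℂ} {Φ : Fin m → Fin m → ℂ}
    (hΦ : ∀ i j, D (Φ i j) = 0) (v : Fin m → ℂ) (i : Fin m) :
    D (apMat Φ v i) = apMat Φ (fun j => D (v j)) i := by
  simp [apMat, map_sum, hΦ]

/-- Parameters: four families of `m × m` arrays, each indexed by `Fin ρ`. -/
abbrev ParamIndex (m ρ : ℕ) := Fin 4 × Fin ρ × Fin m × Fin m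

/-- The vector with the `a`-th standard basis vector as its first `ρ` coordinates, and the
parameters of the family `q` as its other coordinates. -/
noncomputable def headVec {m ρ : ℕ} (P : ParamIndex m ρ → ℂ) (q : Fin 4) (a : Fin ρ)
    (k i : Fin m) : ℂ :=
  if (i : ℕ) < ρ then (if (i : ℕ) = a then 1 else 0) else P (q, a, k, i)

/-- The third factor `z + Φ τ`, for `z` the `k`-th standard basis vector. -/
noncomputable def shiftVec {m ρ : ℕ} (Φ : Fin m → Fin m → ℂ) (P : ParamIndex m ρ → ℂ)
    (a : Fin ρ) (k l : Fin m) : ℂ :=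
  (if l = k then 1 else 0) + apMat Φ (headVec P 3 a k) l

section

variable {m ρ : ℕ} {P : ParamIndex m ρ → ℂ}
  {Δ : (ParamIndex m ρ → ℂ) →ₗ[ℂ] Derivation ℚ ℂ ℂ}

theorem derivation_headVec (hP : ∀ c q, Δ c (P q) = c q) (c : ParamIndex m ρ → ℂ) (q : Fin 4)
    (a : Fin ρ) (k i : Fin m) :
    Δ c (headVec P q a k i) = if (i : ℕ) < ρ then 0 else c (q, a, k, i) := by
  unfold headVec
  split_ifs <;> simp [hP]

theorem derivation_shiftVec (hP : ∀ c q, Δ c (P q) = c q) {Φ : Fin m → Fin m → ℂ}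
    {c : ParamIndex m ρ → ℂ} (hΦ : ∀ i j, Δ c (Φ i j) = 0) (a : Fin ρ) (k l : Fin m) :
    Δ c (shiftVec Φ P a k l) = apMat Φ (fun i => if (i : ℕ) < ρ then 0 else c (3, a, k, i)) l := by
  have : Δ c (if l = k then 1 else 0) = 0 := by split_ifs <;> simp
  simp only [shiftVec, map_add, this, zero_add, derivation_apMat hΦ, derivation_headVec hP]

theorem derivation_shiftVec_eq_zero (hP : ∀ c q, Δ c (P q) = c q) {Φ : Fin m → Fin m → ℂ}
    {c : ParamIndex m ρ → ℂ} (hΦ : ∀ i j, Δ c (Φ i j) = 0) (a : Fin ρ) (k l : Fin m)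
    (hc : ∀ i, c (3, a, k, i) = 0) : Δ c (shiftVec Φ P a k l) = 0 := by
  simp [derivation_shiftVec hP hΦ, hc, apMat]

/-- For every `a`, the complement of a maximal independent set `C a` of vectors
`shiftVec Φ P a k` is small on average. -/
theorem exists_independent_shiftVec (hρ : ρ ≤ m) (hP : ∀ c q, Δ c (P q) = c q)
    (Φ : Fin m → Fin m → ℂ) :
    ∃ C : Fin ρ → Finset (Fin m),
      (∀ a, ∀ c : Fin m → ℂ, (∀ k ∉ C a, c k = 0) → ∑ k, c k • shiftVec Φ P a k = 0 →
        ∀ k, c k = 0) ∧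
      ∀ L : ℕ, L * ∑ a, (C a)ᶜ.card ≤ L ^ 2 * ρ + m ^ 2 := by
  classical
  choose C _ hCind hCspan using fun a =>
    exists_finset_independent_mod (K := ℂ) ⊥ (shiftVec Φ P a) Set.univ
  choose J hJsub hJind hJspan using fun a =>
    exists_finset_independent_mod (K := ℂ) (Submodule.span ℂ (shiftVec Φ P a '' C a)) (fun j l => Φ l j)
      {j | ρ ≤ (j : ℕ)}
  simp only [bot_sup_eq, Set.mem_univ, true_implies] at hCspan
  refine ⟨C, fun a c hc h => hCind a c hc (by simpa using h), fun L => ?_⟩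
  have hdim (a) : (C a)ᶜ.card ≤ 1 + (J a).card := by
    let W := Submodule.span ℂ (shiftVec Φ P a '' C a)
    let U := Submodule.span ℂ ((fun j l => Φ l j) '' (J a : Set (Fin m)))
    let V := Submodule.span ℂ {fun l => Φ l (Fin.castLE hρ a)}
    have htop : (⊤ : Submodule ℂ (Fin m → ℂ)) ≤ V ⊔ (W ⊔ U) := by
      rw [← (Pi.basisFun ℂ (Fin m)).span_eq, Submodule.span_le]
      rintro _ ⟨k, rfl⟩
      have hk : Pi.basisFun ℂ (Fin m) k =
          shiftVec Φ P a k - ∑ j, headVec P 3 a k j • fun l => Φ l j := by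
        ext l
        simp [shiftVec, apMat, Pi.single_apply, mul_comm]
      rw [hk]
      refine Submodule.sub_mem _ ?_ (Submodule.sum_mem _ fun j _ => ?_)
      · exact Submodule.mem_sup_right (Submodule.mem_sup_left (hCspan a k))
      · unfold headVec
        split_ifs with h1 h2
        · obtain rfl : j = Fin.castLE hρ a := Fin.ext h2
          exact Submodule.smul_mem _ _
            (Submodule.mem_sup_left (Submodule.mem_span_singleton_self _))
        · simp
        · exact Submodule.smul_mem _ _ (Submodule.mem_sup_right (hJspan a j (not_lt.1 h1)))
    have h1 := Submodule.finrank_mono htop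
    have h2 := Submodule.finrank_add_le_finrank_add_finrank V (W ⊔ U)
    have h3 := Submodule.finrank_add_le_finrank_add_finrank W U
    have hV : Module.finrank ℂ V ≤ 1 := by
      simpa using finrank_span_le_card (R := ℂ) {fun l => Φ l (Fin.castLE hρ a)}
    have hW : Module.finrank ℂ W ≤ (C a).card := by
      have := finrank_span_finset_le_card (R := ℂ) ((C a).image (shiftVec Φ P a))
      rw [Finset.coe_image] at this
      exact this.trans Finset.card_image_le
    have hU : Module.finrank ℂ U ≤ (J a).card := by
      have := finrank_span_finset_le_card (R := ℂ) ((J a).image fun j l => Φ l j)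
      rw [Finset.coe_image] at this
      exact this.trans Finset.card_image_le
    rw [finrank_top, Module.finrank_fin_fun] at h1
    rw [Finset.card_compl, Fintype.card_fin]
    lia
  have hcard : ∑ a, (C a)ᶜ.card * (J a).card ≤ m ^ 2 := by
    let e : (Σ _ : Fin ρ, Fin m × Fin m) → ParamIndex m ρ := fun p => (3, p.1, p.2.1, p.2.2)
    have he : Function.Injective e := by
      rintro ⟨a, k, j⟩ ⟨a', k', j'⟩ h
      simp only [e, Prod.mk.injEq, true_and] at h
      obtain ⟨rfl, rfl, rfl⟩ := h
      rfl
    have := card_le_of_derivation_injOn Δ (fun y : Fin m × Fin m => Φ y.1 y.2)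
      ((Finset.univ.sigma fun a => (C a)ᶜ ×ˢ J a).image e) ?_
    · simpa [Finset.card_image_of_injective _ he, sq] using this
    intro c hc hΦ
    replace hΦ : ∀ i j, Δ c (Φ i j) = 0 := fun i j => hΦ (i, j)
    have hc' : ∀ q a k j, ¬ (q = 3 ∧ k ∉ C a ∧ j ∈ J a) → c (q, a, k, j) = 0 := by
      intro q a k j h
      refine hc _ fun h' => h ?_
      obtain ⟨⟨a', k', j'⟩, hmem, heq⟩ := Finset.mem_image.1 h'
      simp only [e, Prod.mk.injEq] at heq
      obtain ⟨rfl, rfl, rfl, rfl⟩ := heq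
      simpa using hmem
    have hzero (a k j) : c (3, a, k, j) = 0 := by
      refine hJind a (fun j => c (3, a, k, j)) (fun j hj => hc' _ _ _ _ (by tauto)) ?_ j
      have := derivation_comp_mem_span (Δ c) (s := shiftVec Φ P a '' C a) ?_ (hCspan a k)
      · convert this using 1
        ext l
        rw [derivation_shiftVec hP hΦ]
        simp only [apMat, Finset.sum_apply, Pi.smul_apply, smul_eq_mul]
        refine Finset.sum_congr rfl fun j _ => ?_
        split_ifs with hj
        · rw [hc' _ _ _ _ fun h => (hJsub a h.2.2).not_gt hj]
          simp
        · ring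
      · rintro _ ⟨k', hk', rfl⟩ l
        exact derivation_shiftVec_eq_zero hP hΦ a k' l fun i =>
          hc' _ _ _ _ (fun h => h.2.1 hk')
    rintro ⟨q, a, k, j⟩
    by_cases hq : q = 3
    · rw [hq, hzero]
    · exact hc' _ _ _ _ (by tauto)
  calc L * ∑ a, (C a)ᶜ.card = ∑ a, L * (C a)ᶜ.card := Finset.mul_sum _ _ _
    _ ≤ ∑ a, (L ^ 2 + (C a)ᶜ.card * (J a).card) := by
      refine Finset.sum_le_sum fun a _ => ?_
      have := hdim a
      rcases Nat.eq_zero_or_pos L with rfl | hL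
      · simp
      zify at this hL ⊢
      nlinarith [mul_le_mul_of_nonneg_left this (Int.natCast_nonneg (C a)ᶜ.card),
        sq_nonneg ((L : ℤ) - (C a)ᶜ.card),
        mul_nonneg (Int.natCast_nonneg (C a)ᶜ.card) (sub_nonneg.2 hL)]
    _ = L ^ 2 * ρ + ∑ a, (C a)ᶜ.card * (J a).card := by
      rw [Finset.sum_add_distrib]; simp [mul_comm]
    _ ≤ _ := by lia

end

/-- The matrix multiplying the first vector of the slot `α`. -/
noncomputable def slotMat {m ρ : ℕ} (ΦB ΦC : Fin m → Fin m → ℂ) (P : ParamIndex m ρ → ℂ)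
    (α : Fin ρ × Fin m) (p : Fin m × Fin m) : ℂ :=
  P (1, α.1, α.2, p.1) * shiftVec ΦC P α.1 α.2 p.2 +
    apMat ΦB (fun j => P (2, α.1, α.2, j)) p.1 * if p.2 = α.2 then 1 else 0

/-- The matrix with a single non-zero row `shiftVec Φ P α.1 α.2`, at position `j`. -/
noncomputable def rowMat {m ρ : ℕ} (Φ : Fin m → Fin m → ℂ) (P : ParamIndex m ρ → ℂ)
    (α : Fin ρ × Fin m) (j : Fin m) (p : Fin m × Fin m) : ℂ :=
  if p.1 = j then shiftVec Φ P α.1 α.2 p.2 else 0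

section

variable {m ρ : ℕ} {P : ParamIndex m ρ → ℂ}
  {Δ : (ParamIndex m ρ → ℂ) →ₗ[ℂ] Derivation ℚ ℂ ℂ}

theorem derivation_slotMat (hP : ∀ c q, Δ c (P q) = c q) {ΦB ΦC : Fin m → Fin m → ℂ}
    {c : ParamIndex m ρ → ℂ} (hB : ∀ i j, Δ c (ΦB i j) = 0) (hC : ∀ i j, Δ c (ΦC i j) = 0)
    (h2 : ∀ a k i, c (2, a, k, i) = 0) (h3 : ∀ a k i, c (3, a, k, i) = 0)
    (α : Fin ρ × Fin m) (p : Fin m × Fin m) :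
    Δ c (slotMat ΦB ΦC P α p) = c (1, α.1, α.2, p.1) * shiftVec ΦC P α.1 α.2 p.2 := by
  have h : Δ c (if p.2 = α.2 then 1 else 0) = 0 := by split_ifs <;> simp
  simp only [slotMat, map_add, Derivation.leibniz, hP, derivation_apMat hB, h2,
    derivation_shiftVec_eq_zero hP hC _ _ _ (h3 _ _), h, smul_eq_mul]
  simp [apMat, mul_comm]

theorem card_le_of_rowMat_mem {Φ : Fin m → Fin m → ℂ} {a : Fin ρ} {C R : Finset (Fin m)}
    (hC : ∀ c : Fin m → ℂ, (∀ k ∉ C, c k = 0) → ∑ k, c k • shiftVec Φ P a k = 0 → ∀ k, c k = 0)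
    (hR : R ⊆ C) (W : Submodule ℂ (Fin m × Fin m → ℂ))
    (hW : ∀ k ∈ R, ∀ j, rowMat Φ P (a, k) j ∈ W) :
    m * R.card ≤ Module.finrank ℂ W := by
  classical
  have hind : LinearIndependent ℂ fun q : Fin m × R => rowMat Φ P (a, q.2) q.1 := by
    rw [Fintype.linearIndependent_iff]
    rintro g hg ⟨j, k, hk⟩
    have := hC (fun k => if h : k ∈ R then g (j, ⟨k, h⟩) else 0)
      (fun k hk => dif_neg fun h => hk (hR h)) ?_ k
    · simpa [hk] using this
    ext l
    have h := congrFun hg (j, l)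
    simp only [Finset.sum_apply, Pi.smul_apply, smul_eq_mul, rowMat, Fintype.sum_prod_type,
      mul_ite, mul_zero, Pi.zero_apply] at h
    rw [Finset.sum_comm] at h
    simp only [Finset.sum_ite_eq, Finset.mem_univ, if_true] at h
    simp only [Finset.sum_apply, Pi.smul_apply, smul_eq_mul, dite_mul, zero_mul, Pi.zero_apply]
    refine ((Finset.sum_subset (Finset.subset_univ R) fun x _ hx => dif_neg hx).symm.trans ?_).trans
      h
    rw [← Finset.sum_coe_sort R]
    simp
  have := Submodule.finrank_mono (R := ℂ) (Submodule.span_le.2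
    (show Set.range (fun q : Fin m × R => rowMat Φ P (a, q.2) q.1) ⊆ W by
      rintro _ ⟨q, rfl⟩
      exact hW _ q.2.2 _))
  rw [finrank_span_eq_card hind] at this
  simpa using this

/-- There is a large independent set `B` of matrices `slotMat ΦB ΦC P α`. -/
theorem exists_independent_slotMat (hP : ∀ c q, Δ c (P q) = c q)
    (ΦB ΦC : Fin m → Fin m → ℂ) {C : Fin ρ → Finset (Fin m)}
    (hC : ∀ a, ∀ c : Fin m → ℂ, (∀ k ∉ C a, c k = 0) → ∑ k, c k • shiftVec ΦC P a k = 0 →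
        ∀ k, c k = 0) :
    ∃ B : Finset (Fin ρ × Fin m), LinearIndepOn ℂ (slotMat ΦB ΦC P) (B : Set (Fin ρ × Fin m)) ∧
      m * Bᶜ.card ≤ m * ∑ a : Fin ρ, ((a : ℕ) + 1) + 2 * m ^ 2 + m * ∑ a, (C a)ᶜ.card := by
  classical
  obtain ⟨B', hBind, hBspan⟩ := exists_linearIndepOn_forall_mem_span (K := ℂ)
    (fun α : Fin ρ × Fin m => (α.1 : ℕ)) (slotMat ΦB ΦC P)
  obtain ⟨B, rfl⟩ : ∃ B : Finset (Fin ρ × Fin m), (B : Set _) = B' :=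
    ⟨B'.toFinset, Set.coe_toFinset B'⟩
  refine ⟨B, hBind, ?_⟩
  let W (a : Fin ρ) : Submodule ℂ (Fin m × Fin m → ℂ) :=
    Submodule.span ℂ (slotMat ΦB ΦC P '' {β ∈ (B : Set (Fin ρ × Fin m)) | (β.1 : ℕ) ≤ a})
  choose J _ hJind hJspan using fun α : Fin ρ × Fin m =>
    exists_finset_independent_mod (K := ℂ) (W α.1) (rowMat ΦC P α) Set.univ
  let Q (a : Fin ρ) : Finset (Fin m) := Finset.univ.filter fun k => (a, k) ∉ B
  have hcard : ∑ a, ∑ k ∈ Q a, (J (a, k)).card ≤ 2 * m ^ 2 := by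
    let e : (Σ _ : Fin ρ, Σ _ : Fin m, Fin m) → ParamIndex m ρ := fun p => (1, p.1, p.2.1, p.2.2)
    have he : Function.Injective e := by
      rintro ⟨a, k, j⟩ ⟨a', k', j'⟩ h
      simp only [e, Prod.mk.injEq, true_and] at h
      obtain ⟨rfl, rfl, rfl⟩ := h
      rfl
    have := card_le_of_derivation_injOn Δ (Sum.elim (fun y : Fin m × Fin m => ΦB y.1 y.2)
      (fun y : Fin m × Fin m => ΦC y.1 y.2))
      ((Finset.univ.sigma fun a => (Q a).sigma fun k => J (a, k)).image e) ?_
    · simpa [Finset.card_image_of_injective _ he, sq, two_mul] using this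
    intro c hc hΦ
    have hB : ∀ i j, Δ c (ΦB i j) = 0 := fun i j => hΦ (Sum.inl (i, j))
    have hC : ∀ i j, Δ c (ΦC i j) = 0 := fun i j => hΦ (Sum.inr (i, j))
    have hc' : ∀ q a k j, ¬ (q = 1 ∧ (a, k) ∉ B ∧ j ∈ J (a, k)) → c (q, a, k, j) = 0 := by
      intro q a k j h
      refine hc _ fun h' => h ?_
      obtain ⟨⟨a', k', j'⟩, hmem, heq⟩ := Finset.mem_image.1 h'
      simp only [e, Prod.mk.injEq] at heq
      obtain ⟨rfl, rfl, rfl, rfl⟩ := heq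
      simpa [Q] using hmem
    have hslot := derivation_slotMat hP hB hC (fun _ _ _ => hc' _ _ _ _ (by simp))
      (fun _ _ _ => hc' _ _ _ _ (by simp))
    have hzero (a k j) : c (1, a, k, j) = 0 := by
      refine hJind (a, k) (fun j => c (1, a, k, j)) (fun j hj => hc' _ _ _ _ (by tauto)) ?_ j
      have := derivation_comp_mem_span (Δ c) ?_ (hBspan (a, k))
      · convert this using 1
        ext p
        rw [hslot]
        simp [rowMat]
      · rintro _ ⟨β, hβ, rfl⟩ p
        rw [hslot, hc' _ _ _ _ fun h => h.2.1 hβ.1, zero_mul]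
    rintro ⟨q, a, k, j⟩
    by_cases hq : q = 1
    · rw [hq, hzero]
    · exact hc' _ _ _ _ (by tauto)
  have hrow (a : Fin ρ) : m * (Q a ∩ C a).card ≤
      m * ((a : ℕ) + 1) + ∑ k ∈ Q a, (J (a, k)).card := by
    let F := (Q a).sigma fun k => J (a, k)
    let U := Submodule.span ℂ
      ((F.image fun q => rowMat ΦC P (a, q.1) q.2 : Finset (Fin m × Fin m → ℂ)) :
        Set (Fin m × Fin m → ℂ))
    have h1 := card_le_of_rowMat_mem (hC a) Finset.inter_subset_right (W a ⊔ U) fun k hk j => by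
      have hkQ := (Finset.mem_inter.1 hk).1
      refine SetLike.le_def.1 (sup_le_sup_left (Submodule.span_mono ?_) (W a))
        (hJspan (a, k) j (Set.mem_univ j))
      rintro _ ⟨j, hj, rfl⟩
      simp only [Finset.coe_image]
      exact ⟨⟨k, j⟩, Finset.mem_sigma.2 ⟨hkQ, hj⟩, rfl⟩
    have h2 := Submodule.finrank_add_le_finrank_add_finrank (W a) U
    have hU : Module.finrank ℂ U ≤ ∑ k ∈ Q a, (J (a, k)).card :=
      (finrank_span_finset_le_card _).trans
        (Finset.card_image_le.trans (Finset.card_sigma _ _).le)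
    have hW : Module.finrank ℂ (W a) ≤ m * ((a : ℕ) + 1) := by
      have hsub : (B.filter fun β => (β.1 : ℕ) ≤ a) ⊆ Finset.Iic a ×ˢ Finset.univ := by
        intro β hβ
        simpa using (Finset.mem_filter.1 hβ).2
      have h3 := finrank_span_finset_le_card (R := ℂ)
        ((B.filter fun β => (β.1 : ℕ) ≤ a).image (slotMat ΦB ΦC P))
      rw [Finset.coe_image, Finset.coe_filter] at h3
      refine h3.trans (Finset.card_image_le.trans ((Finset.card_le_card hsub).trans ?_))
      simp [mul_comm]
    lia
  have hQ : Bᶜ.card = ∑ a, (Q a).card := by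
    rw [← Finset.card_sigma]
    refine Finset.card_bij' (fun α _ => ⟨α.1, α.2⟩) (fun p _ => (p.1, p.2)) ?_ ?_ ?_ ?_ <;>
      simp [Q]
  have hQC (a) : (Q a).card ≤ (Q a ∩ C a).card + (C a)ᶜ.card := by
    refine (Finset.card_le_card fun k hk => ?_).trans (Finset.card_union_le _ _)
    by_cases h : k ∈ C a <;> simp [h, hk]
  calc m * Bᶜ.card = ∑ a, m * (Q a).card := by rw [hQ, Finset.mul_sum]
    _ ≤ ∑ a : Fin ρ, (m * ((a : ℕ) + 1) + ∑ k ∈ Q a, (J (a, k)).card + m * (C a)ᶜ.card) := by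
      refine Finset.sum_le_sum fun a _ => ?_
      have := Nat.mul_le_mul_left m (hQC a)
      have := hrow a
      lia
    _ ≤ _ := by
      simp only [Finset.sum_add_distrib, ← Finset.mul_sum] at hcard ⊢
      lia

end

section

variable {m ρ : ℕ} {P : ParamIndex m ρ → ℂ}
  {Δ : (ParamIndex m ρ → ℂ) →ₗ[ℂ] Derivation ℚ ℂ ℂ}

/-- Counting parameters in a decomposition of length `s`. -/
theorem card_add_card_le_of_decomposition (hρ : ρ ≤ m) (hP : ∀ c q, Δ c (P q) = c q)
    {ΦA ΦB ΦC : Fin m → Fin m → ℂ} {C : Fin ρ → Finset (Fin m)}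
    (hC : ∀ a, ∀ c : Fin m → ℂ, (∀ k ∉ C a, c k = 0) → ∑ k, c k • shiftVec ΦC P a k = 0 →
        ∀ k, c k = 0)
    {B : Finset (Fin ρ × Fin m)}
    (hB : LinearIndepOn ℂ (slotMat ΦB ΦC P) (B : Set (Fin ρ × Fin m)))
    {s : ℕ} (u v w : Fin s → Fin m → ℂ)
    (h : ∀ i j l, ∑ α : Fin ρ × Fin m, headVec P 0 α.1 α.2 i * slotMat ΦB ΦC P α (j, l) +
      ΦA i l * ∑ a, P (1, a, l, j) = ∑ t, u t i * v t j * w t l) :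
    (∑ a, (C a).card) * m + B.card * (m - ρ) ≤ 4 * m ^ 2 + 3 * (s * m) := by
  classical
  let e : (Σ _ : Fin ρ, Fin m × Fin m) ⊕ (Fin ρ × Fin m) × Fin m → ParamIndex m ρ :=
    Sum.elim (fun p => (1, p.1, p.2.1, p.2.2)) (fun p => (0, p.1.1, p.1.2, p.2))
  have he : Function.Injective e := by
    rintro (⟨a, k, j⟩ | ⟨⟨a, k⟩, j⟩) (⟨a', k', j'⟩ | ⟨⟨a', k'⟩, j'⟩) h <;>
      simp [e] at h <;> obtain ⟨rfl, rfl, rfl⟩ := h <;> rfl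
  let H : Finset (Fin m) := Finset.univ.filter fun i => ρ ≤ (i : ℕ)
  have hH : H.card = m - ρ := by
    have h1 := Finset.card_filter_add_card_filter_not (s := (Finset.univ : Finset (Fin m)))
      (fun i => ρ ≤ (i : ℕ))
    have h2 : (Finset.univ.filter fun i : Fin m => ¬ ρ ≤ (i : ℕ)).card = ρ := by
      simp only [not_le, Fin.card_filter_val_lt]
      exact min_eq_right hρ
    rw [h2, Finset.card_univ, Fintype.card_fin] at h1
    exact Nat.eq_sub_of_add_eq h1
  let sq : Type := Fin m × Fin m
  have := card_le_of_derivation_injOn Δ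
    (Sum.elim (Sum.elim (fun y : sq => ΦA y.1 y.2) (fun y : sq => ΦB y.1 y.2))
      (Sum.elim (Sum.elim (fun y : sq => ΦC y.1 y.2) (fun y : sq => ∑ a, P (1, a, y.2, y.1)))
        (Sum.elim (fun y : Fin s × Fin m => u y.1 y.2)
          (Sum.elim (fun y : Fin s × Fin m => v y.1 y.2) fun y : Fin s × Fin m => w y.1 y.2))))
    (((Finset.univ.sigma fun a => C a ×ˢ Finset.univ).disjSum (B ×ˢ H)).image e) ?_
  · rw [Finset.card_image_of_injective _ he, Finset.card_disjSum, Finset.card_product, hH] at this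
    simp only [Finset.card_sigma, Finset.card_product, Finset.card_univ, Fintype.card_fin,
      ← Finset.sum_mul, Fintype.card_sum, sq, Fintype.card_prod] at this
    lia
  intro c hc hgen
  have hA : ∀ i j, Δ c (ΦA i j) = 0 := fun i j => hgen (.inl (.inl (i, j)))
  have hΦB : ∀ i j, Δ c (ΦB i j) = 0 := fun i j => hgen (.inl (.inr (i, j)))
  have hΦC : ∀ i j, Δ c (ΦC i j) = 0 := fun i j => hgen (.inr (.inl (.inl (i, j))))
  have hS : ∀ j l, Δ c (∑ a, P (1, a, l, j)) = 0 := fun j l => hgen (.inr (.inl (.inr (j, l))))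
  have hu : ∀ t i, Δ c (u t i) = 0 := fun t i => hgen (.inr (.inr (.inl (t, i))))
  have hv : ∀ t i, Δ c (v t i) = 0 := fun t i => hgen (.inr (.inr (.inr (.inl (t, i)))))
  have hw : ∀ t i, Δ c (w t i) = 0 := fun t i => hgen (.inr (.inr (.inr (.inr (t, i)))))
  have hc' : ∀ q a (k j : Fin m), ¬ (q = 1 ∧ k ∈ C a ∨ q = 0 ∧ (a, k) ∈ B ∧ ρ ≤ (j : ℕ)) →
      c (q, a, k, j) = 0 := by
    intro q a k j h
    refine hc _ fun h' => h ?_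
    obtain ⟨⟨a', k', j'⟩ | ⟨⟨a', k'⟩, j'⟩, hmem, heq⟩ := Finset.mem_image.1 h'
    all_goals
      simp only [e, Sum.elim_inl, Sum.elim_inr, Prod.mk.injEq] at heq
      obtain ⟨rfl, rfl, rfl, rfl⟩ := heq
      simpa [H] using hmem
  have hslot := derivation_slotMat hP hΦB hΦC (fun _ _ _ => hc' _ _ _ _ (by simp))
    (fun _ _ _ => hc' _ _ _ _ (by simp))
  have hD (i j l) : ∑ α : Fin ρ × Fin m,
      (headVec P 0 α.1 α.2 i * (c (1, α.1, α.2, j) * shiftVec ΦC P α.1 α.2 l) +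
        slotMat ΦB ΦC P α (j, l) * if (i : ℕ) < ρ then 0 else c (0, α.1, α.2, i)) = 0 := by
    have := congrArg (Δ c) (h i j l)
    simp only [map_add, map_sum, Derivation.leibniz, hslot, derivation_headVec hP,
      smul_eq_mul, hu, hv, hw, hA, mul_zero, add_zero, Finset.sum_const_zero] at this
    rw [← map_sum, hS, mul_zero, add_zero] at this
    exact this
  have h1 (a k j) : c (1, a, k, j) = 0 := by
    refine hC a (fun k => c (1, a, k, j)) (fun k hk => hc' _ _ _ _ (by simp [hk])) ?_ k
    ext l
    have := hD (Fin.castLE hρ a) j l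
    simpa [Fintype.sum_prod_type, headVec, Fin.val_inj] using this
  have h0 (a k i) : c (0, a, k, i) = 0 := by
    by_cases hi : (i : ℕ) < ρ
    · exact hc' _ _ _ _ (by simp [hi])
    by_cases hak : (a, k) ∈ B
    · refine linearIndepOn_finset_iff.1 hB (fun α => c (0, α.1, α.2, i)) ?_ _ hak
      rw [Finset.sum_subset (Finset.subset_univ B)]
      · ext ⟨j, l⟩
        have := hD i j l
        simpa [h1, hi, mul_comm] using this
      · intro α _ hα
        rw [hc' _ _ _ _ (by simp [hα]), zero_smul]
    · exact hc' _ _ _ _ (by simp [hak])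
  rintro ⟨q, a, k, j⟩
  by_cases hq : q = 1
  · rw [hq, h1]
  by_cases hq : q = 0
  · rw [hq, h0]
  · exact hc' _ _ _ _ (by tauto)

/-- Numerical bounds on the length `s` of a decomposition of the tensor at the special point. -/
theorem exists_bounds_of_decomposition (hρ : ρ ≤ m) (hP : ∀ c q, Δ c (P q) = c q)
    (ΦA ΦB ΦC : Fin m → Fin m → ℂ) {s : ℕ} (u v w : Fin s → Fin m → ℂ)
    (h : ∀ i j l, ∑ α : Fin ρ × Fin m,
      (headVec P 0 α.1 α.2 i * P (1, α.1, α.2, j) * (if l = α.2 then 1 else 0) +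
        ΦA i α.2 * P (1, α.1, α.2, j) * (if l = α.2 then 1 else 0) +
        headVec P 0 α.1 α.2 i * apMat ΦB (fun j => P (2, α.1, α.2, j)) j *
          (if l = α.2 then 1 else 0) +
        headVec P 0 α.1 α.2 i * P (1, α.1, α.2, j) * apMat ΦC (headVec P 3 α.1 α.2) l) =
      ∑ t, u t i * v t j * w t l) :
    ∃ κ θ : ℕ, (∀ L : ℕ, L * κ ≤ L ^ 2 * ρ + m ^ 2) ∧
      m * θ ≤ m * ∑ a : Fin ρ, ((a : ℕ) + 1) + 2 * m ^ 2 + m * κ ∧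
      ρ * m * m + ρ * m * (m - ρ) ≤ 4 * m ^ 2 + 3 * (s * m) + κ * m + θ * (m - ρ) := by
  obtain ⟨C, hC, hκ⟩ := exists_independent_shiftVec hρ hP ΦC
  obtain ⟨B, hB, hθ⟩ := exists_independent_slotMat hP ΦB ΦC hC
  refine ⟨_, _, hκ, hθ, ?_⟩
  have key := card_add_card_le_of_decomposition (ΦA := ΦA) hρ hP hC hB u v w fun i j l => by
    rw [← h i j l]
    have : ΦA i l * ∑ a, P (1, a, l, j) =
        ∑ α : Fin ρ × Fin m, ΦA i α.2 * P (1, α.1, α.2, j) * (if l = α.2 then 1 else 0) := by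
      simp [Fintype.sum_prod_type, Finset.mul_sum]
    rw [this, ← Finset.sum_add_distrib]
    refine Finset.sum_congr rfl fun α _ => ?_
    simp only [slotMat, shiftVec]
    ring
  have h1 : ∑ a, (C a).card + ∑ a, (C a)ᶜ.card = ρ * m := by
    simp [← Finset.sum_add_distrib, Finset.card_add_card_compl]
  have h2 : B.card + Bᶜ.card = ρ * m := by
    simp [Finset.card_add_card_compl]
  calc ρ * m * m + ρ * m * (m - ρ)
      = ((∑ a, (C a).card) * m + B.card * (m - ρ)) +
        ((∑ a, (C a)ᶜ.card) * m + Bᶜ.card * (m - ρ)) := by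
        nth_rewrite 1 [← h1]
        rw [← h2]
        ring
    _ ≤ _ := by lia

end

/-- The leading coefficients in `M ^ 3` of the two sides of `h` contradict each other. -/
theorem false_of_real_bounds {M R K T S σ d : ℝ} (hM : 10 ^ 7 < M) (hR : 3 * R + d = M) (hd0 : 0 ≤ d)
    (hd2 : d ≤ 2) (hσ : 2 * σ = R * (R + 1)) (hK : 1000 * K ≤ 1000 ^ 2 * R + M ^ 2)
    (hT : M * T ≤ M * σ + 2 * M ^ 2 + M * K)
    (h : R * M * M + R * M * (M - R) ≤ 4 * M ^ 2 + 3 * (S * M) + K * M + T * (M - R))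
    (hS : S ≤ ((1 + 1 / 100) * M ^ 2 / 3 + 1) / 2) (hK0 : 0 ≤ K) : False := by
  have hM0 : 0 < M := by linarith
  have hR0 : 0 < R := by linarith
  have hT' : T ≤ σ + 2 * M + K := by
    refine le_of_mul_le_mul_left ?_ hM0
    linarith
  have h1 : T * (M - R) ≤ σ * (M - R) + (2 * M + K) * M := by
    have := mul_le_mul_of_nonneg_right hT' (by linarith : 0 ≤ M - R)
    nlinarith [mul_nonneg hK0 hR0.le, mul_nonneg hM0.le hR0.le]
  have h2 : 3 * (S * M) ≤ 3 * (((1 + 1 / 100) * M ^ 2 / 3 + 1) / 2 * M) := by gcongr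
  have h3 : K * M ≤ (1000 * R + M ^ 2 / 1000) * M := by gcongr; linarith
  obtain rfl : σ = R * (R + 1) / 2 := by linarith
  have h4 : R * M * M + R * M * (M - R) - R * (R + 1) / 2 * (M - R) ≤
      6 * M ^ 2 + 3 * (((1 + 1 / 100) * M ^ 2 / 3 + 1) / 2 * M) +
        2 * ((1000 * R + M ^ 2 / 1000) * M) := by linarith
  clear h h1 h2 h3 hT hT' hS hσ hK hK0
  obtain rfl : d = M - 3 * R := by linarith
  have hRM : R ≤ M / 3 := by linarith
  have hRM' : M / 3 - 1 ≤ R := by linarith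
  obtain ⟨e, he⟩ : ∃ e, e = M / 3 - R := ⟨_, rfl⟩
  obtain rfl : R = M / 3 - e := by linarith
  have he0 : 0 ≤ e := by linarith
  have he1 : e ≤ 1 := by linarith
  have hM2 : 10 ^ 7 * M ^ 2 ≤ M ^ 3 := by nlinarith [sq_nonneg M]
  have hM1 : 10 ^ 7 * M ≤ M ^ 2 := by nlinarith
  have e1 : e * M ^ 2 ≤ M ^ 2 := by nlinarith [sq_nonneg M]
  have e2 : 0 ≤ e * M := by positivity
  have e4 : e ^ 2 * M ≤ M := by nlinarith
  have e5 : e ^ 3 ≤ 1 := pow_le_one₀ he0 he1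
  have e7 : e * M ≤ M := by nlinarith
  have e8 : 0 ≤ e ^ 2 := by positivity
  ring_nf at h4 hM1 hM2 e1 e2 e4 e5 e7 e8
  linarith only [h4, hM, hM1, hM2, e1, e2, e4, e5, e7, e8]

theorem rme_div_two_lt_of_bounds {m s κ θ : ℕ} (hm : 10 ^ 7 < m)
    (hκ : ∀ L : ℕ, L * κ ≤ L ^ 2 * (m / 3) + m ^ 2)
    (hθ : m * θ ≤ m * ∑ a : Fin (m / 3), ((a : ℕ) + 1) + 2 * m ^ 2 + m * κ)
    (h : m / 3 * m * m + m / 3 * m * (m - m / 3) ≤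
      4 * m ^ 2 + 3 * (s * m) + κ * m + θ * (m - m / 3)) :
    (rme m (1 / 100) : ℝ) / 2 < s := by
  have hsum : ∀ n : ℕ, 2 * ∑ a : Fin n, ((a : ℕ) + 1) = n * (n + 1) := by
    intro n
    rw [Fin.sum_univ_eq_sum_range (fun a => a + 1)]
    induction n with
    | zero => rfl
    | succ n ih => rw [Finset.sum_range_succ, mul_add, ih]; ring
  have hr : (rme m (1 / 100) : ℝ) < (1 + 1 / 100) * (m : ℝ) ^ 2 / 3 + 1 :=
    Nat.ceil_lt_add_one (by positivity)
  by_contra! hs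
  have hs' := hs.trans (by linarith : (rme m (1 / 100) : ℝ) / 2 ≤
    ((1 + 1 / 100) * (m : ℝ) ^ 2 / 3 + 1) / 2)
  have hρ : m / 3 ≤ m := Nat.div_le_self m 3
  have hd3 := Nat.div_add_mod m 3
  have hd := Nat.mod_lt m (show 0 < 3 by norm_num)
  have hsum' := hsum (m / 3)
  have hT : (m : ℝ) * θ ≤ m * (∑ a : Fin (m / 3), ((a : ℕ) + 1) : ℕ) + 2 * m ^ 2 + m * κ := by
    exact_mod_cast hθ
  refine false_of_real_bounds (M := m) (R := (m / 3 : ℕ)) (K := κ) (T := θ) (S := s)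
    (d := (m % 3 : ℕ)) (by exact_mod_cast hm) (by exact_mod_cast hd3) (by positivity)
    (by exact_mod_cast Nat.le_of_lt_succ hd) (by exact_mod_cast hsum') (by exact_mod_cast hκ 1000)
    hT ?_ hs' (by positivity)
  rw [← Nat.cast_sub hρ]
  exact_mod_cast h

/-- The rank of a tensor is attained. -/
theorem exists_decomposition_rank3 {m : ℕ} (T : Fin m × Fin m × Fin m → ℂ) :
    ∃ u v w : Fin (rank3 T) → Fin m → ℂ, ∀ i j l, T (i, j, l) = ∑ t, u t i * v t j * w t l := by
  have hne : {r : ℕ | ∃ x y z : Fin r → Fin m → ℂ,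
      T = fun p => ∑ α, x α p.1 * y α p.2.1 * z α p.2.2}.Nonempty := by
    let e := Fintype.equivFin (Fin m × Fin m × Fin m)
    refine ⟨_, fun t i => if i = (e.symm t).1 then T (e.symm t) else 0,
      fun t j => if j = (e.symm t).2.1 then 1 else 0,
      fun t l => if l = (e.symm t).2.2 then 1 else 0, ?_⟩
    ext ⟨i, j, l⟩
    rw [Equiv.sum_comp e.symm fun q : Fin m × Fin m × Fin m => (if i = q.1 then T q else 0) *
      (if j = q.2.1 then 1 else 0) * if l = q.2.2 then 1 else 0]
    simp [Fintype.sum_prod_type]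
  obtain ⟨u, v, w, h⟩ := Nat.sInf_mem hne
  exact ⟨u, v, w, fun i j l => congrFun h (i, j, l)⟩

theorem T1_extend {m r : ℕ} {ι : Type*} [Fintype ι] {g : ι → Fin r} (hg : Function.Injective g)
    (x y z ξ η τ : ι → Fin m → ℂ) (ΦA ΦB ΦC : Fin m → Fin m → ℂ) (i j l : Fin m) :
    T1 (Function.extend g x 0) (Function.extend g y 0) (Function.extend g z 0)
      (Function.extend g ξ 0) (Function.extend g η 0) (Function.extend g τ 0) ΦA ΦB ΦC (i, j, l) =
    ∑ α, (x α i * y α j * z α l + apMat ΦA (ξ α) i * y α j * z α l +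
      x α i * apMat ΦB (η α) j * z α l + x α i * y α j * apMat ΦC (τ α) l) := by
  refine (Fintype.sum_of_injective g hg _ _ (fun β hβ => ?_) fun α => ?_).symm
  · simp [Function.extend_apply' _ _ _ hβ]
  · simp [hg.extend_apply]

/-- **Key existence lemma for Shitov's Claim 6.** There exist `ε > 0` and `m̄ ∈ ℤ_{>0}` such
that for every `m > m̄` the intersection `V¹_{m,ε} ∩ V²_{m,ε}` is nonempty: there is a point
`p = (xᵅ,yᵅ,zᵅ,ξᵅ,ηᵅ,τᵅ)` such that every modification `T¹` and every modification `T²` has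
rank greater than `r_{m,ε}/2`. -/
theorem exists_point_in_V1_inter_V2 :
    ∃ ε : ℝ, 0 < ε ∧ ∃ mbar : ℕ, 0 < mbar ∧ ∀ m : ℕ, mbar < m →
      ∃ x y z ξ η τ : Fin (rme m ε) → Fin m → ℂ,
        (∀ ΦA ΦB ΦC : Fin m → Fin m → ℂ,
          (rme m ε : ℝ) / 2 < (rank3 (T1 x y z ξ η τ ΦA ΦB ΦC) : ℝ)) ∧
        (∀ ΦA ΦB ΦC : Fin m → Fin m → ℂ,
          (rme m ε : ℝ) / 2 < (rank3 (T2 x y z ξ η τ ΦA ΦB ΦC) : ℝ)) := by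
  refine ⟨1 / 100, by norm_num, 10 ^ 7, by norm_num, fun m hm => ?_⟩
  obtain ⟨P, Δ, hP⟩ := exists_derivations (ParamIndex m (m / 3))
  have hρ : m / 3 ≤ m := Nat.div_le_self m 3
  obtain ⟨g, hg⟩ : ∃ g : Fin (m / 3) × Fin m → Fin (rme m (1 / 100)), Function.Injective g := by
    obtain ⟨f⟩ := Function.Embedding.nonempty_of_card_le
      (α := Fin (m / 3) × Fin m) (β := Fin (rme m (1 / 100))) (by
        simp only [Fintype.card_prod, Fintype.card_fin]
        have h : ((m / 3 : ℕ) : ℝ) ≤ m / 3 := Nat.cast_div_le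
        have h' : (1 + 1 / 100) * (m : ℝ) ^ 2 / 3 ≤ rme m (1 / 100) := Nat.le_ceil _
        have : ((m / 3 * m : ℕ) : ℝ) ≤ rme m (1 / 100) := by
          push_cast
          nlinarith [(Nat.cast_nonneg m : (0 : ℝ) ≤ m)]
        exact_mod_cast this)
    exact ⟨f, f.injective⟩
  let unit : Fin (m / 3) × Fin m → Fin m → ℂ := fun α l => if l = α.2 then 1 else 0
  have hunit (Φ : Fin m → Fin m → ℂ) (α i) : apMat Φ (unit α) i = Φ i α.2 := by
    simp [apMat, unit]
  let x : Fin (m / 3) × Fin m → Fin m → ℂ := fun α => headVec P 0 α.1 α.2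
  let y : Fin (m / 3) × Fin m → Fin m → ℂ := fun α j => P (1, α.1, α.2, j)
  let η : Fin (m / 3) × Fin m → Fin m → ℂ := fun α j => P (2, α.1, α.2, j)
  let τ : Fin (m / 3) × Fin m → Fin m → ℂ := fun α => headVec P 3 α.1 α.2
  refine ⟨Function.extend g x 0, Function.extend g y 0, Function.extend g unit 0,
    Function.extend g unit 0, Function.extend g η 0, Function.extend g τ 0,
    fun ΦA ΦB ΦC => ?_, fun ΦA ΦB ΦC => ?_⟩
  · obtain ⟨u, v, w, h⟩ := exists_decomposition_rank3 (T1 (Function.extend g x 0)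
      (Function.extend g y 0) (Function.extend g unit 0) (Function.extend g unit 0)
      (Function.extend g η 0) (Function.extend g τ 0) ΦA ΦB ΦC)
    obtain ⟨κ, θ, h1, h2, h3⟩ := exists_bounds_of_decomposition hρ hP ΦA ΦB ΦC u v w
      fun i j l => by
        rw [← h, T1_extend hg]
        simp only [hunit]
        rfl
    exact rme_div_two_lt_of_bounds hm h1 h2 h3
  · obtain ⟨u, v, w, h⟩ := exists_decomposition_rank3 (T2 (Function.extend g x 0)
      (Function.extend g y 0) (Function.extend g unit 0) (Function.extend g unit 0)
      (Function.extend g η 0) (Function.extend g τ 0) ΦA ΦB ΦC)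
    let σ : ParamIndex m (m / 3) → ParamIndex m (m / 3) := fun q => (q.1.rev, q.2)
    have hσ : ∀ q, σ (σ q) = q := fun q => by simp [σ]
    obtain ⟨κ, θ, h1, h2, h3⟩ := exists_bounds_of_decomposition hρ
      (P := P ∘ σ) (Δ := Δ ∘ₗ LinearMap.funLeft ℂ ℂ σ)
      (fun c q => by simp [hP, LinearMap.funLeft_apply, hσ]) ΦC ΦB ΦA w v u
      fun i j l => by
        have hT : ∑ α, (unit α l * η α j * τ α i + apMat ΦA (x α) l * η α j * τ α i +
            unit α l * apMat ΦB (y α) j * τ α i + unit α l * η α j * ΦC i α.2) =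
            ∑ t, u t l * v t j * w t i := by
          rw [← h]
          refine Eq.trans ?_ (T1_extend hg unit η τ x y unit ΦA ΦB ΦC l j i).symm
          simp only [hunit]
        have hw : ∑ t, w t i * v t j * u t l = ∑ t, u t l * v t j * w t i :=
          Finset.sum_congr rfl fun t _ => by ring
        rw [hw, ← hT]
        refine Finset.sum_congr rfl fun α _ => ?_
        change τ α i * η α j * unit α l + ΦC i α.2 * η α j * unit α l +
          τ α i * apMat ΦB (y α) j * unit α l + τ α i * η α j * apMat ΦA (x α) l = _
        ring
    exact rme_div_two_lt_of_bounds hm h1 h2 h3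
end
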